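/- arXiv:1507.04187 — 2 statements merged into one kernel-verified Lean document; each statement's English description precedes it below -/
import Mathlib

section
/- Let d ≥ 1, let ρ_0, ρ_1 be absolutely continuous Borel probability measures on ℝ^d with finite second moments, let v : ℝ^d → ℝ be convex and differentiable ρ_0-a.e. with T := ∇v satisfying T_#ρ_0 = ρ_1, and set ρ_t := ((1−t)·id + t·T)_#ρ_0 for t ∈ [0,1]. Let μ ∈ P_1(ℝ^d) be centered. Then t ↦ T(ρ_t,μ) is convex on [0,1]. Moreover, if γ is a Borel probability measure on ℝ^d × ℝ^d with marginals ρ_0 and μ such that ∫ ⟨x,y⟩ dγ = T(ρ_0,μ) < ∞, then for every t ∈ [0,1] one has T(ρ_t,μ) ≥ T(ρ_0,μ) + t · ∫ ⟨T(x) − x, y⟩ dγ(x,y). -/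
open MeasureTheory Real Filter Topology
open scoped ENNReal RealInnerProductSpace

noncomputable section

/-- `d`-dimensional Euclidean space. -/
abbrev Ed (d : ℕ) := EuclideanSpace ℝ (Fin d)

open Classical in
/-- The entropy `E(ρ) = ∫ f ln f dx` (extended-real-valued, computed as positive part minus
negative part of the integral of `f ln f`, where `f` is the density), and `+∞` if `ρ` is not
absolutely continuous w.r.t. Lebesgue measure. -/
def entropy {d : ℕ} (ρ : Measure (Ed d)) : EReal :=
  if ρ ≪ (volume : Measure (Ed d)) then
    ((∫⁻ x, ENNReal.ofReal ((ρ.rnDeriv volume x).toReal *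
        Real.log (ρ.rnDeriv volume x).toReal) : ℝ≥0∞) : EReal)
      - ((∫⁻ x, ENNReal.ofReal (-((ρ.rnDeriv volume x).toReal *
        Real.log (ρ.rnDeriv volume x).toReal)) : ℝ≥0∞) : EReal)
  else ⊤

/-- The (extended-real-valued) integral `∫ ⟨x,y⟩ dγ(x,y)`: positive part minus negative part. -/
def pairInt {d : ℕ} (γ : Measure (Ed d × Ed d)) : EReal :=
  ((∫⁻ p, ENNReal.ofReal (⟪p.1, p.2⟫ : ℝ) ∂γ : ℝ≥0∞) : EReal)
    - ((∫⁻ p, ENNReal.ofReal (-(⟪p.1, p.2⟫ : ℝ)) ∂γ : ℝ≥0∞) : EReal)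

/-- Transport plans: probability measures on the product with marginals `ρ` and `μ`. -/
def Couplings {d : ℕ} (ρ μ : Measure (Ed d)) : Set (Measure (Ed d × Ed d)) :=
  {γ | IsProbabilityMeasure γ ∧ γ.fst = ρ ∧ γ.snd = μ}

/-- The maximal correlation functional `T(ρ,μ) = sup { ∫⟨x,y⟩ dγ : γ ∈ Π(ρ,μ) }`. -/
def maxCorr {d : ℕ} (ρ μ : Measure (Ed d)) : EReal :=
  ⨆ γ ∈ Couplings ρ μ, pairInt γ

/-- `ρ` has finite first moment. -/
def FirstMoment {d : ℕ} (ρ : Measure (Ed d)) : Prop := Integrable (fun x => ‖x‖) ρ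

/-- `ρ` is centered: its barycenter is `0`. -/
def Centered {d : ℕ} (ρ : Measure (Ed d)) : Prop := (∫ x, x ∂ρ) = 0

/-- Weak convergence of measures: convergence of integrals of bounded continuous functions. -/
def WeakConv {d : ℕ} (ρs : ℕ → Measure (Ed d)) (ρ : Measure (Ed d)) : Prop :=
  ∀ f : BoundedContinuousFunction (Ed d) ℝ,
    Tendsto (fun n => ∫ x, f x ∂(ρs n)) atTop (𝓝 (∫ x, f x ∂ρ))

/-- Convexity for extended-real-valued functions on `Ed d`. -/
def EConvexOn {d : ℕ} (u : Ed d → EReal) : Prop :=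
  ∀ x y : Ed d, ∀ a b : ℝ, 0 ≤ a → 0 ≤ b → a + b = 1 →
    u (a • x + b • y) ≤ (a : EReal) * u x + (b : EReal) * u y

/-- `e^{-t}` for `t ∈ ℝ ∪ {+∞}`, with `e^{-∞} = 0`. -/
def expNegE (t : EReal) : ℝ := if t = ⊤ then 0 else Real.exp (-t.toReal)

/-- The Legendre transform `u*(y) = sup_x (⟨x,y⟩ - u(x))`. -/
def legendre {d : ℕ} (u : Ed d → EReal) (y : Ed d) : EReal :=
  ⨆ x : Ed d, (((⟪x, y⟫ : ℝ) : EReal) - u x)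

/-- The essential continuity of a convex l.s.c. function `u : ℝ^d → ℝ ∪ {+∞}`:
`u` tends to `+∞` at `H^{d-1}`-a.e. point of the boundary of its domain. -/
def EssentiallyContinuous {d : ℕ} (u : Ed d → EReal) : Prop :=
  μH[(d : ℝ) - 1] {x : Ed d | x ∈ frontier {y | u y < ⊤} ∧ u x < ⊤} = 0

/-- Gluing: a plan whose first marginal is an image measure `f_# ρ` lifts to a plan with first
marginal `ρ`. -/
lemma exists_lift_of_fst_eq_map {X Y Z : Type*} [MeasurableSpace X] [StandardBorelSpace X]
    [Nonempty X] [MeasurableSpace Y] [MeasurableEq Y] [MeasurableSpace Z]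
    (ρ : Measure X) [IsProbabilityMeasure ρ] {f : X → Y} (hf : Measurable f)
    (γ : Measure (Y × Z)) [IsProbabilityMeasure γ] (hγ : γ.fst = ρ.map f) :
    ∃ σ : Measure (X × Z), IsProbabilityMeasure σ ∧ σ.fst = ρ ∧
      σ.map (fun p => (f p.1, p.2)) = γ := by
  set m : Measure (Y × X) := ρ.map (fun x => (f x, x)) with hm
  have hmeas : Measurable (fun x => (f x, x)) := hf.prodMk measurable_id
  have : IsProbabilityMeasure m := Measure.isProbabilityMeasure_map hmeas.aemeasurable
  have hmfst : m.fst = γ.fst := by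
    rw [hγ, hm, Measure.fst, Measure.map_map measurable_fst hmeas]; rfl
  set κ := m.condKernel.comap (Prod.fst : Y × Z → Y) measurable_fst with hκ
  set Q := γ.compProd κ with hQ
  have hQfst : Q.map Prod.fst = γ := Measure.fst_compProd γ κ
  have hg : Measurable (fun q : (Y × Z) × X => (q.1.1, q.2)) := by fun_prop
  have hQm : Q.map (fun q => (q.1.1, q.2)) = m := by
    rw [← m.disintegrate m.condKernel, hmfst]
    ext s hs
    rw [Measure.map_apply hg hs, Measure.compProd_apply (hg hs), Measure.compProd_apply hs,
      Measure.fst, lintegral_map (ProbabilityTheory.Kernel.measurable_kernel_prodMk_left hs)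
        measurable_fst]
    rfl
  have hae : ∀ᵐ q ∂Q, q.1.1 = f q.2 := by
    have h1 : ∀ᵐ p ∂m, p.1 = f p.2 := by
      rw [hm, ae_map_iff (p := fun p => p.1 = f p.2) hmeas.aemeasurable
        (measurableSet_eq_fun measurable_fst (hf.comp measurable_snd))]
      exact Eventually.of_forall fun _ => rfl
    rw [← hQm] at h1
    exact ae_of_ae_map hg.aemeasurable h1
  have hσ : Measurable (fun q : (Y × Z) × X => (q.2, q.1.2)) := by fun_prop
  refine ⟨Q.map (fun q => (q.2, q.1.2)), Measure.isProbabilityMeasure_map hσ.aemeasurable, ?_, ?_⟩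
  · rw [Measure.fst, Measure.map_map measurable_fst hσ]
    have h2 := congrArg Measure.snd hQm
    rw [Measure.snd, Measure.map_map measurable_snd hg, Measure.snd, hm,
      Measure.map_map measurable_snd hmeas] at h2
    exact h2.trans Measure.map_id
  · rw [Measure.map_map (by fun_prop) hσ]
    refine (Measure.map_congr ?_).trans hQfst
    filter_upwards [hae] with q hq
    simp [← hq]

lemma integrable_of_lintegral_ofReal_ne_top {α : Type*} [MeasurableSpace α] {ν : Measure α}
    {F : α → ℝ} (hF : Measurable F) (hpos : ∫⁻ x, ENNReal.ofReal (F x) ∂ν ≠ ⊤)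
    (hneg : ∫⁻ x, ENNReal.ofReal (-F x) ∂ν ≠ ⊤) : Integrable F ν := by
  refine ⟨hF.aestronglyMeasurable, ?_⟩
  refine lt_of_le_of_lt (b := ∫⁻ x, (ENNReal.ofReal (F x) + ENNReal.ofReal (-F x)) ∂ν)
    (lintegral_mono fun x => ?_) ?_
  · rw [Real.enorm_eq_ofReal_abs]
    rcases le_total 0 (F x) with h | h
    · rw [abs_of_nonneg h]; exact le_self_add
    · rw [abs_of_nonpos h]; exact le_add_self
  · rw [lintegral_add_left hF.ennreal_ofReal]
    exact ENNReal.add_lt_top.2 ⟨hpos.lt_top, hneg.lt_top⟩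

lemma pairInt_eq_integral {d : ℕ} {γ : Measure (Ed d × Ed d)}
    (h : Integrable (fun p => (⟪p.1, p.2⟫ : ℝ)) γ) :
    pairInt γ = ((∫ p, (⟪p.1, p.2⟫ : ℝ) ∂γ : ℝ) : EReal) := by
  have hp : ∫⁻ p, ENNReal.ofReal (⟪p.1, p.2⟫ : ℝ) ∂γ ≠ ⊤ := h.lintegral_lt_top.ne
  have hn : ∫⁻ p, ENNReal.ofReal (-(⟪p.1, p.2⟫ : ℝ)) ∂γ ≠ ⊤ := h.neg.lintegral_lt_top.ne
  rw [integral_eq_lintegral_pos_part_sub_lintegral_neg_part h, pairInt, EReal.coe_sub,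
    EReal.coe_ennreal_toReal hp, EReal.coe_ennreal_toReal hn]

lemma pairInt_map_eq_integral {d : ℕ} {σ : Measure (Ed d × Ed d)} {f : Ed d → Ed d}
    (hf : Measurable f) (h : Integrable (fun p => (⟪f p.1, p.2⟫ : ℝ)) σ) :
    pairInt (σ.map (fun p => (f p.1, p.2))) = ((∫ p, (⟪f p.1, p.2⟫ : ℝ) ∂σ : ℝ) : EReal) := by
  have hm : AEMeasurable (fun p : Ed d × Ed d => (f p.1, p.2)) σ := by fun_prop
  have hs : AEStronglyMeasurable (fun p : Ed d × Ed d => (⟪p.1, p.2⟫ : ℝ))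
    (σ.map (fun p => (f p.1, p.2))) := by fun_prop
  rw [pairInt_eq_integral ((integrable_map_measure hs hm).2 h), integral_map hm hs]

lemma pairInt_le_maxCorr {d : ℕ} {ρ μ : Measure (Ed d)} {γ : Measure (Ed d × Ed d)}
    (h : γ ∈ Couplings ρ μ) : pairInt γ ≤ maxCorr ρ μ :=
  le_iSup₂_of_le γ h le_rfl

lemma integrable_inner_prod {d : ℕ} {ρ μ : Measure (Ed d)} [IsFiniteMeasure ρ]
    [IsFiniteMeasure μ] (hρ : FirstMoment ρ) (hμ : FirstMoment μ) :
    Integrable (fun p : Ed d × Ed d => (⟪p.1, p.2⟫ : ℝ)) (ρ.prod μ) := by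
  refine (hρ.mul_prod hμ).mono' (by fun_prop) (Eventually.of_forall fun p => ?_)
  exact norm_inner_le_norm p.1 p.2

lemma maxCorr_ne_bot {d : ℕ} {ρ μ : Measure (Ed d)} [IsProbabilityMeasure ρ]
    [IsProbabilityMeasure μ] (hρ : FirstMoment ρ) (hμ : FirstMoment μ) : maxCorr ρ μ ≠ ⊥ := by
  have h := pairInt_le_maxCorr (γ := ρ.prod μ) (ρ := ρ) (μ := μ)
    ⟨inferInstance, Measure.fst_prod, Measure.snd_prod⟩
  rw [pairInt_eq_integral (integrable_inner_prod hρ hμ)] at h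
  exact ((EReal.bot_lt_coe _).trans_le h).ne'

/-- Keep a plan on `A` and replace it on `Aᶜ` by the independent plan with the same marginals. -/
lemma exists_coupling_integral_ge {d : ℕ} {ρ μ : Measure (Ed d)} (hρ : FirstMoment ρ)
    (hμ : FirstMoment μ) {γ : Measure (Ed d × Ed d)} (hγ : γ ∈ Couplings ρ μ)
    {A : Set (Ed d × Ed d)} (hA : MeasurableSet A) (hA0 : γ Aᶜ ≠ 0)
    (hint : IntegrableOn (fun p : Ed d × Ed d => (⟪p.1, p.2⟫ : ℝ)) A γ) :
    (((∫ p in A, (⟪p.1, p.2⟫ : ℝ) ∂γ)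
      - (γ Aᶜ).toReal⁻¹ * ((∫ x, ‖x‖ ∂ρ) * (∫ y, ‖y‖ ∂μ)) : ℝ) : EReal) ≤ maxCorr ρ μ := by
  obtain ⟨hprob, hfst, hsnd⟩ := hγ
  set α := (γ.restrict Aᶜ).fst with hα
  set β := (γ.restrict Aᶜ).snd with hβ
  have hαρ : α ≤ ρ := by rw [← hfst]; exact Measure.map_mono Measure.restrict_le_self measurable_fst
  have hβμ : β ≤ μ := by rw [← hsnd]; exact Measure.map_mono Measure.restrict_le_self measurable_snd
  have hα1 : FirstMoment α := Integrable.mono_measure hρ hαρ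
  have hβ1 : FirstMoment β := Integrable.mono_measure hμ hβμ
  have hαu : α Set.univ = γ Aᶜ := by rw [hα, Measure.fst_univ, Measure.restrict_apply_univ]
  have hβu : β Set.univ = γ Aᶜ := by rw [hβ, Measure.snd_univ, Measure.restrict_apply_univ]
  set c := (γ Aᶜ)⁻¹ with hc
  have hctop : c ≠ ⊤ := ENNReal.inv_ne_top.2 hA0
  have hc1 : c * γ Aᶜ = 1 := ENNReal.inv_mul_cancel hA0 (measure_ne_top _ _)
  have hi : Integrable (fun p : Ed d × Ed d => (⟪p.1, p.2⟫ : ℝ)) (c • α.prod β) :=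
    (integrable_inner_prod hα1 hβ1).smul_measure hctop
  set γ' := γ.restrict A + c • α.prod β with hγ'
  have hfst' : γ'.fst = ρ := by
    rw [hγ', Measure.fst_add, Measure.fst, Measure.fst, Measure.map_smul,
      Measure.map_fst_prod, hβu, smul_smul, hc1, one_smul, hα, Measure.fst,
      ← Measure.map_add _ _ measurable_fst, Measure.restrict_add_restrict_compl hA]
    exact hfst
  have hsnd' : γ'.snd = μ := by
    rw [hγ', Measure.snd_add, Measure.snd, Measure.snd, Measure.map_smul,
      Measure.map_snd_prod, hαu, smul_smul, hc1, one_smul, hβ, Measure.snd,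
      ← Measure.map_add _ _ measurable_snd, Measure.restrict_add_restrict_compl hA]
    exact hsnd
  have hprob' : IsProbabilityMeasure γ' := by
    refine ⟨?_⟩
    rw [← Measure.fst_univ, hfst', ← hfst, Measure.fst_univ, measure_univ]
  refine le_trans ?_ (pairInt_le_maxCorr ⟨hprob', hfst', hsnd'⟩)
  rw [pairInt_eq_integral (hint.integrable.add_measure hi), EReal.coe_le_coe_iff,
    integral_add_measure hint.integrable hi, integral_smul_measure, sub_eq_add_neg]
  gcongr
  have hcr : c.toReal = (γ Aᶜ).toReal⁻¹ := ENNReal.toReal_inv _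
  rw [hcr, smul_eq_mul, ← mul_neg]
  gcongr
  have h1 : -∫ p : Ed d × Ed d, ‖p.1‖ * ‖p.2‖ ∂(α.prod β) ≤ ∫ p, (⟪p.1, p.2⟫ : ℝ) ∂(α.prod β) := by
    rw [← integral_neg]
    exact integral_mono (hα1.mul_prod hβ1).neg (integrable_inner_prod hα1 hβ1)
      fun p => neg_le_of_abs_le (abs_real_inner_le_norm p.1 p.2)
  refine le_trans (neg_le_neg ?_) h1
  rw [integral_prod_mul (fun x : Ed d => ‖x‖) (fun y : Ed d => ‖y‖)]
  exact mul_le_mul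
    (integral_mono_measure hαρ (Eventually.of_forall fun x => norm_nonneg x) hρ)
    (integral_mono_measure hβμ (Eventually.of_forall fun x => norm_nonneg x) hμ)
    (integral_nonneg fun x => norm_nonneg x) (integral_nonneg fun x => norm_nonneg x)

lemma maxCorr_eq_top {d : ℕ} {ρ μ : Measure (Ed d)} (hρ : FirstMoment ρ)
    (hμ : FirstMoment μ) {γ : Measure (Ed d × Ed d)} (hγ : γ ∈ Couplings ρ μ)
    (htop : ∫⁻ p, ENNReal.ofReal (⟪p.1, p.2⟫ : ℝ) ∂γ = ⊤) : maxCorr ρ μ = ⊤ := by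
  have hprob := hγ.1
  have hmeas : Measurable (fun p : Ed d × Ed d => (⟪p.1, p.2⟫ : ℝ)) := by fun_prop
  set N := {p : Ed d × Ed d | (⟪p.1, p.2⟫ : ℝ) < 0} with hN
  by_cases hN0 : γ N = 0
  · refine top_le_iff.1 (le_trans (le_of_eq ?_) (pairInt_le_maxCorr hγ))
    have h0 : ∫⁻ p, ENNReal.ofReal (-(⟪p.1, p.2⟫ : ℝ)) ∂γ = 0 := by
      rw [lintegral_eq_zero_iff (by fun_prop)]
      have : ∀ᵐ p ∂γ, p ∉ N := measure_eq_zero_iff_ae_notMem.1 hN0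
      filter_upwards [this] with p hp
      simpa [hN] using hp
    rw [pairInt, htop, h0]
    simp
  set A : ℕ → Set (Ed d × Ed d) :=
    fun n => {p | 0 ≤ (⟪p.1, p.2⟫ : ℝ)} ∩ {p | (⟪p.1, p.2⟫ : ℝ) ≤ n} with hAdef
  have hA : ∀ n, MeasurableSet (A n) := fun n =>
    (measurableSet_le measurable_const hmeas).inter (measurableSet_le hmeas measurable_const)
  have hmono : Monotone A := fun m n hmn p hp =>
    ⟨hp.1, le_trans (b := (m : ℝ)) hp.2 (Nat.cast_le.2 hmn)⟩
  have hNA : ∀ n, N ⊆ (A n)ᶜ := fun n p (hp : (⟪p.1, p.2⟫ : ℝ) < 0) hpA =>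
    absurd hpA.1 (not_le.2 hp : ¬ 0 ≤ (⟪p.1, p.2⟫ : ℝ))
  have hA0 : ∀ n, γ (A n)ᶜ ≠ 0 := fun n h => hN0 (measure_mono_null (hNA n) h)
  have hint : ∀ n, IntegrableOn (fun p : Ed d × Ed d => (⟪p.1, p.2⟫ : ℝ)) (A n) γ := by
    intro n
    refine Measure.integrableOn_of_bounded (M := n) (measure_ne_top _ _)
      hmeas.aestronglyMeasurable ?_
    filter_upwards [ae_restrict_mem (hA n)] with p hp
    rw [Real.norm_of_nonneg hp.1]
    exact hp.2
  have hsup : ⨆ n, ∫⁻ p in A n, ENNReal.ofReal (⟪p.1, p.2⟫ : ℝ) ∂γ = ⊤ := by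
    rw [← setLIntegral_iUnion_of_directed _ (directed_of_isDirected_le hmono), ← htop,
      ← lintegral_indicator (MeasurableSet.iUnion hA)]
    refine lintegral_congr fun p => ?_
    by_cases hp : 0 ≤ (⟪p.1, p.2⟫ : ℝ)
    · obtain ⟨n, hn⟩ := exists_nat_ge (⟪p.1, p.2⟫ : ℝ)
      exact Set.indicator_of_mem (s := ⋃ n, A n) (Set.mem_iUnion.2 ⟨n, hp, hn⟩) _
    · rw [Set.indicator_of_notMem, ENNReal.ofReal_of_nonpos (not_le.1 hp).le]
      intro hmem
      obtain ⟨n, hn⟩ := Set.mem_iUnion.1 hmem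
      exact hp hn.1
  set C := (γ N).toReal⁻¹ * ((∫ x, ‖x‖ ∂ρ) * (∫ y, ‖y‖ ∂μ)) with hC
  rw [EReal.eq_top_iff_forall_lt]
  intro M
  obtain ⟨n, hn⟩ := lt_iSup_iff.1 ((ENNReal.ofReal_lt_top (r := M + C)).trans_eq hsup.symm)
  rw [← ofReal_integral_eq_lintegral_ofReal (hint n)
    ((ae_restrict_mem (hA n)).mono fun p hp => hp.1)] at hn
  refine lt_of_lt_of_le ?_ (exists_coupling_integral_ge hρ hμ hγ (hA n) (hA0 n) (hint n))
  have h1 := (ENNReal.ofReal_lt_ofReal_iff'.1 hn).1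
  rw [EReal.coe_lt_coe_iff]
  have h2 : (γ (A n)ᶜ).toReal⁻¹ * ((∫ x, ‖x‖ ∂ρ) * (∫ y, ‖y‖ ∂μ)) ≤ C := by
    rw [hC]
    gcongr
    · exact ENNReal.toReal_pos hN0 (measure_ne_top _ _)
    · exact measure_ne_top _ _
    · exact hNA n
  linarith

lemma map_mem_couplings {d : ℕ} {ρ μ : Measure (Ed d)} {σ : Measure (Ed d × Ed d)}
    (hσ : σ ∈ Couplings ρ μ) {f : Ed d → Ed d} (hf : Measurable f) :
    σ.map (fun p => (f p.1, p.2)) ∈ Couplings (ρ.map f) μ := by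
  obtain ⟨hprob, rfl, rfl⟩ := hσ
  have hm : Measurable (fun p : Ed d × Ed d => (f p.1, p.2)) := by fun_prop
  refine ⟨Measure.isProbabilityMeasure_map hm.aemeasurable, ?_, ?_⟩
  · rw [Measure.fst, Measure.fst, Measure.map_map measurable_fst hm,
      Measure.map_map hf measurable_fst]; rfl
  · rw [Measure.snd, Measure.map_map measurable_snd hm]; rfl

lemma maxCorr_map_le {d : ℕ} {ρ μ : Measure (Ed d)} [IsProbabilityMeasure ρ]
    [IsProbabilityMeasure μ] {f g : Ed d → Ed d} (hf : Measurable f) (hg : Measurable g)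
    (hfi : Integrable f ρ) (hgi : Integrable g ρ) (hμ : FirstMoment μ)
    {a b : ℝ} (ha : 0 < a) (hb : 0 < b) :
    maxCorr (ρ.map (fun x => a • f x + b • g x)) μ ≤
      (a : EReal) * maxCorr (ρ.map f) μ + (b : EReal) * maxCorr (ρ.map g) μ := by
  have hmoment : ∀ {f : Ed d → Ed d}, Measurable f → Integrable f ρ → FirstMoment (ρ.map f) :=
    fun hf hi => (integrable_map_measure (by fun_prop) hf.aemeasurable).2 hi.norm
  have hf1 := hmoment hf hfi
  have hg1 := hmoment hg hgi
  have : IsProbabilityMeasure (ρ.map f) := Measure.isProbabilityMeasure_map hf.aemeasurable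
  have : IsProbabilityMeasure (ρ.map g) := Measure.isProbabilityMeasure_map hg.aemeasurable
  have hmulbot : ∀ {c : ℝ} {z : EReal}, 0 < c → z ≠ ⊥ → (c : EReal) * z ≠ ⊥ := by
    intro c z hc hz
    induction z with
    | bot => exact absurd rfl hz
    | coe z => rw [← EReal.coe_mul]; exact EReal.coe_ne_bot _
    | top => rw [EReal.coe_mul_top_of_pos hc]; exact top_ne_bot
  refine iSup₂_le fun γ hγ => ?_
  obtain ⟨hγp, hγf, hγs⟩ := hγ
  obtain ⟨σ, hσp, hσf, hσγ⟩ := exists_lift_of_fst_eq_map ρ (by fun_prop) γ hγf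
  have hσ : σ ∈ Couplings ρ μ := by
    refine ⟨hσp, hσf, ?_⟩
    rw [← hγs, ← hσγ, Measure.snd, Measure.snd, Measure.map_map measurable_snd (by fun_prop)]
    rfl
  have hFc := map_mem_couplings hσ hf
  have hGc := map_mem_couplings hσ hg
  have hF : Measurable (fun p : Ed d × Ed d => (⟪f p.1, p.2⟫ : ℝ)) := by fun_prop
  have hG : Measurable (fun p : Ed d × Ed d => (⟪g p.1, p.2⟫ : ℝ)) := by fun_prop
  by_cases hFp : ∫⁻ p, ENNReal.ofReal (⟪f p.1, p.2⟫ : ℝ) ∂σ = ⊤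
  · rw [maxCorr_eq_top hf1 hμ hFc
      (by rw [lintegral_map (by fun_prop) (by fun_prop)]; exact hFp),
      EReal.coe_mul_top_of_pos ha, EReal.top_add_of_ne_bot (hmulbot hb (maxCorr_ne_bot hg1 hμ))]
    exact le_top
  by_cases hGp : ∫⁻ p, ENNReal.ofReal (⟪g p.1, p.2⟫ : ℝ) ∂σ = ⊤
  · rw [maxCorr_eq_top hg1 hμ hGc
      (by rw [lintegral_map (by fun_prop) (by fun_prop)]; exact hGp),
      EReal.coe_mul_top_of_pos hb, EReal.add_top_of_ne_bot (hmulbot ha (maxCorr_ne_bot hf1 hμ))]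
    exact le_top
  by_cases hHn : ∫⁻ p, ENNReal.ofReal (-(⟪a • f p.1 + b • g p.1, p.2⟫ : ℝ)) ∂σ = ⊤
  · rw [pairInt, ← hσγ, lintegral_map (f := fun p : Ed d × Ed d => ENNReal.ofReal (-(⟪p.1, p.2⟫ : ℝ)))
      (by fun_prop) (by fun_prop), hHn]
    simp
  have hneg : ∀ {F G H : Ed d × Ed d → ℝ} {a b : ℝ}, 0 < a → 0 < b → Measurable F →
      Measurable G → Measurable H → (∀ p, H p = a * F p + b * G p) →
      ∫⁻ p, ENNReal.ofReal (G p) ∂σ ≠ ⊤ → ∫⁻ p, ENNReal.ofReal (-H p) ∂σ ≠ ⊤ →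
      ∫⁻ p, ENNReal.ofReal (-F p) ∂σ ≠ ⊤ := by
    intro F G H a b ha hb hF hG hH hH' hGp hHn
    have h1 : ENNReal.ofReal a * ∫⁻ p, ENNReal.ofReal (-F p) ∂σ ≤
        ∫⁻ p, ENNReal.ofReal (-H p) ∂σ + ENNReal.ofReal b * ∫⁻ p, ENNReal.ofReal (G p) ∂σ := by
      rw [← lintegral_const_mul _ (by fun_prop), ← lintegral_const_mul _ (by fun_prop),
        ← lintegral_add_left (by fun_prop)]
      refine lintegral_mono fun p => ?_
      rw [← ENNReal.ofReal_mul ha.le, ← ENNReal.ofReal_mul hb.le]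
      refine le_trans (ENNReal.ofReal_le_ofReal (le_of_eq ?_)) ENNReal.ofReal_add_le
      rw [hH']; ring
    intro h
    rw [h, ENNReal.mul_top (by simpa using ha), top_le_iff] at h1
    exact ENNReal.add_ne_top.2 ⟨hHn, ENNReal.mul_ne_top ENNReal.ofReal_ne_top hGp⟩ h1
  have hH' : ∀ p : Ed d × Ed d, (⟪a • f p.1 + b • g p.1, p.2⟫ : ℝ) =
      a * ⟪f p.1, p.2⟫ + b * ⟪g p.1, p.2⟫ := fun p => by
    rw [inner_add_left, real_inner_smul_left, real_inner_smul_left]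
  have hH : Measurable (fun p : Ed d × Ed d => (⟪a • f p.1 + b • g p.1, p.2⟫ : ℝ)) := by fun_prop
  have hFi : Integrable (fun p : Ed d × Ed d => (⟪f p.1, p.2⟫ : ℝ)) σ :=
    integrable_of_lintegral_ofReal_ne_top hF hFp (hneg ha hb hF hG hH hH' hGp hHn)
  have hGi : Integrable (fun p : Ed d × Ed d => (⟪g p.1, p.2⟫ : ℝ)) σ :=
    integrable_of_lintegral_ofReal_ne_top hG hGp
      (hneg hb ha hG hF hH (fun p => (hH' p).trans (add_comm _ _)) hFp hHn)
  have hle := add_le_add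
    (mul_le_mul_of_nonneg_left (pairInt_le_maxCorr hFc) (EReal.coe_nonneg.2 ha.le))
    (mul_le_mul_of_nonneg_left (pairInt_le_maxCorr hGc) (EReal.coe_nonneg.2 hb.le))
  refine le_trans (le_of_eq ?_) hle
  rw [← hσγ, pairInt_map_eq_integral hf hFi, pairInt_map_eq_integral hg hGi,
    pairInt_map_eq_integral (f := fun x => a • f x + b • g x) (by fun_prop)
      (((hFi.const_mul a).add (hGi.const_mul b)).congr (Eventually.of_forall fun p => (hH' p).symm)),
    integral_congr_ae (Eventually.of_forall hH'),
    integral_add (hFi.const_mul a) (hGi.const_mul b), integral_const_mul, integral_const_mul]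
  push_cast
  rfl

/-- displacement convexity of `t ↦ T(ρ_t,μ)` along the Wasserstein geodesic
`ρ_t = ((1-t)id + t∇v)_#ρ_0`, together with the lower bound
`T(ρ_t,μ) ≥ T(ρ_0,μ) + t ∫⟨∇v(x) - x, y⟩ dγ` for an optimal plan `γ` from `ρ_0` to `μ`. -/
theorem maxCorr_displacement_convex {d : ℕ} (hd : 1 ≤ d)
    (ρ₀ ρ₁ : Measure (Ed d)) [IsProbabilityMeasure ρ₀] [IsProbabilityMeasure ρ₁]
    (hac₀ : ρ₀ ≪ (volume : Measure (Ed d))) (hac₁ : ρ₁ ≪ (volume : Measure (Ed d)))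
    (h2₀ : Integrable (fun x => ‖x‖ ^ 2) ρ₀) (h2₁ : Integrable (fun x => ‖x‖ ^ 2) ρ₁)
    (v : Ed d → ℝ) (hv : ConvexOn ℝ Set.univ v)
    (hdiff : ∀ᵐ x ∂ρ₀, DifferentiableAt ℝ v x)
    (hpush : ρ₀.map (fun x => gradient v x) = ρ₁)
    (ρt : ℝ → Measure (Ed d))
    (hρt : ∀ t : ℝ, ρt t = ρ₀.map (fun x => (1 - t) • x + t • gradient v x))
    (μ : Measure (Ed d)) [IsProbabilityMeasure μ] (hμ1 : FirstMoment μ) (hμc : Centered μ) :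
    (∀ s ∈ Set.Icc (0 : ℝ) 1, ∀ t ∈ Set.Icc (0 : ℝ) 1, ∀ a b : ℝ,
        0 ≤ a → 0 ≤ b → a + b = 1 →
        maxCorr (ρt (a * s + b * t)) μ ≤
          (a : EReal) * maxCorr (ρt s) μ + (b : EReal) * maxCorr (ρt t) μ) ∧
    (∀ γ : Measure (Ed d × Ed d), γ ∈ Couplings ρ₀ μ →
      Integrable (fun p => (⟪p.1, p.2⟫ : ℝ)) γ →
      ((∫ p, (⟪p.1, p.2⟫ : ℝ) ∂γ : ℝ) : EReal) = maxCorr ρ₀ μ →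
      Integrable (fun p => (⟪gradient v p.1 - p.1, p.2⟫ : ℝ)) γ →
      ∀ t ∈ Set.Icc (0 : ℝ) 1,
        maxCorr ρ₀ μ + (t : EReal) * ((∫ p, (⟪gradient v p.1 - p.1, p.2⟫ : ℝ) ∂γ : ℝ) : EReal)
          ≤ maxCorr (ρt t) μ) := by
  have hT : Measurable (fun x => gradient v x) :=
    (InnerProductSpace.toDual ℝ (Ed d)).symm.continuous.measurable.comp (measurable_fderiv ℝ v)
  have hid : Integrable (fun x : Ed d => x) ρ₀ :=
    MemLp.integrable one_le_two
      ((memLp_two_iff_integrable_sq_norm (by fun_prop)).2 h2₀)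
  have hTi : Integrable (fun x => gradient v x) ρ₀ := by
    refine MemLp.integrable one_le_two
      ((memLp_two_iff_integrable_sq_norm hT.aestronglyMeasurable).2 ?_)
    rw [← hpush] at h2₁
    exact (integrable_map_measure (by fun_prop) hT.aemeasurable).1 h2₁
  have hm : ∀ t : ℝ, Measurable (fun x => (1 - t) • x + t • gradient v x) := fun t =>
    (measurable_id.const_smul (1 - t)).add (hT.const_smul t)
  have hi : ∀ t : ℝ, Integrable (fun x => (1 - t) • x + t • gradient v x) ρ₀ := fun t =>
    (hid.smul (1 - t)).add (hTi.smul t)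
  refine ⟨?_, ?_⟩
  · intro s _ t _ a b ha hb hab
    rcases ha.eq_or_lt with rfl | ha
    · obtain rfl : b = 1 := by linarith
      simp
    rcases hb.eq_or_lt with rfl | hb
    · obtain rfl : a = 1 := by linarith
      simp
    rw [hρt (a * s + b * t), hρt s, hρt t]
    convert maxCorr_map_le (hm s) (hm t) (hi s) (hi t) hμ1 ha hb using 4 with x
    obtain rfl : b = 1 - a := by linarith
    module
  · intro γ hγ hint hopt hgrad t _
    have hinner : ∀ p : Ed d × Ed d, (⟪(1 - t) • p.1 + t • gradient v p.1, p.2⟫ : ℝ) =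
        ⟪p.1, p.2⟫ + t * ⟪gradient v p.1 - p.1, p.2⟫ := fun p => by
      rw [inner_add_left, real_inner_smul_left, real_inner_smul_left, inner_sub_left]
      ring
    have h := pairInt_le_maxCorr (map_mem_couplings hγ (hm t))
    rw [pairInt_map_eq_integral (hm t) ((hint.add (hgrad.const_mul t)).congr
        (Eventually.of_forall fun p => (hinner p).symm)),
      integral_congr_ae (Eventually.of_forall hinner), integral_add hint (hgrad.const_mul t),
      integral_const_mul, ← hρt t, EReal.coe_add, EReal.coe_mul, hopt] at h
    exact h
end
end

section
/- Let d ≥ 1 and let μ ∈ P_1(ℝ^d) be centered and not supported on an affine hyperplane (there is no e ∈ ℝ^d with |e| = 1 and ℓ ∈ ℝ such that μ({y : ⟨y,e⟩ = ℓ}) = 1). Then the minimization problem min{ E(ρ) + T(ρ,μ) : ρ ∈ P_1(ℝ^d) } admits a solution: there exists ρ̄ ∈ P_1(ℝ^d) such that E(ρ̄) + T(ρ̄,μ) is finite and E(ρ̄) + T(ρ̄,μ) ≤ E(ρ) + T(ρ,μ) for every ρ ∈ P_1(ℝ^d). -/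
open MeasureTheory Real Filter Topology
open scoped ENNReal RealInnerProductSpace

noncomputable section

/-- The extended-real-valued integral: integral of the positive part minus integral of the
negative part (equal to `⊥` when the negative part is not integrable). -/
def extIntegral {α : Type*} [MeasurableSpace α] (m : Measure α) (F : α → ℝ) : EReal :=
  ((∫⁻ x, ENNReal.ofReal (F x) ∂m : ℝ≥0∞) : EReal)
    - ((∫⁻ x, ENNReal.ofReal (-F x) ∂m : ℝ≥0∞) : EReal)

section ExtIntegral

variable {α β : Type*} [MeasurableSpace α] [MeasurableSpace β] {m : Measure α} {F G : α → ℝ}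

lemma extIntegral_of_integrable (hF : Integrable F m) :
    extIntegral m F = ((∫ x, F x ∂m : ℝ) : EReal) := by
  have h1 := hF.lintegral_lt_top.ne
  have h2 : ∫⁻ x, ENNReal.ofReal (-F x) ∂m ≠ ⊤ := hF.neg.lintegral_lt_top.ne
  rw [integral_eq_lintegral_pos_part_sub_lintegral_neg_part hF, extIntegral, EReal.coe_sub,
    EReal.coe_ennreal_toReal h1, EReal.coe_ennreal_toReal h2]

lemma extIntegral_mono (h : ∀ x, F x ≤ G x) : extIntegral m F ≤ extIntegral m G := by
  refine EReal.sub_le_sub ?_ ?_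
  · exact EReal.coe_ennreal_le_coe_ennreal_iff.2
      (lintegral_mono fun x => ENNReal.ofReal_le_ofReal (h x))
  · exact EReal.coe_ennreal_le_coe_ennreal_iff.2
      (lintegral_mono fun x => ENNReal.ofReal_le_ofReal (neg_le_neg (h x)))

lemma extIntegral_congr_ae (h : F =ᵐ[m] G) : extIntegral m F = extIntegral m G := by
  unfold extIntegral
  congr 2
  · exact lintegral_congr_ae (h.mono fun x hx => by simp only [hx])
  · exact lintegral_congr_ae (h.mono fun x hx => by simp only [hx])

lemma extIntegral_eq_bot (h : ∫⁻ x, ENNReal.ofReal (-F x) ∂m = ⊤) : extIntegral m F = ⊥ := by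
  simp [extIntegral, h]

lemma extIntegral_eq_top (h : ∫⁻ x, ENNReal.ofReal (F x) ∂m = ⊤)
    (h' : ∫⁻ x, ENNReal.ofReal (-F x) ∂m ≠ ⊤) : extIntegral m F = ⊤ := by
  rw [extIntegral, h, ← EReal.coe_ennreal_toReal h']
  simp

lemma integrable_of_lintegral_ofReal_ne_top_s13 (hF : AEStronglyMeasurable F m)
    (h : ∫⁻ x, ENNReal.ofReal (F x) ∂m ≠ ⊤)
    (h' : ∫⁻ x, ENNReal.ofReal (-F x) ∂m ≠ ⊤) : Integrable F m := by
  refine ⟨hF, ?_⟩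
  rw [hasFiniteIntegral_iff_norm]
  have : ∀ x, ENNReal.ofReal ‖F x‖ = ENNReal.ofReal (F x) + ENNReal.ofReal (-F x) := by
    intro x
    rcases le_total 0 (F x) with hx | hx
    · rw [ENNReal.ofReal_of_nonpos (neg_nonpos.2 hx), Real.norm_of_nonneg hx, add_zero]
    · rw [ENNReal.ofReal_of_nonpos hx, Real.norm_of_nonpos hx, zero_add]
  simp_rw [this]
  rw [lintegral_add_left' hF.aemeasurable.ennreal_ofReal]
  exact ENNReal.add_lt_top.2 ⟨h.lt_top, h'.lt_top⟩

lemma lintegral_ofReal_add_ne_top (hG : Integrable G m)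
    (h : ∫⁻ x, ENNReal.ofReal (F x) ∂m ≠ ⊤) :
    ∫⁻ x, ENNReal.ofReal (F x + G x) ∂m ≠ ⊤ := by
  have hle : ∫⁻ x, ENNReal.ofReal (F x + G x) ∂m
      ≤ ∫⁻ x, ENNReal.ofReal (F x) ∂m + ∫⁻ x, ENNReal.ofReal (G x) ∂m := by
    rw [← lintegral_add_right' _ hG.aemeasurable.ennreal_ofReal]
    exact lintegral_mono fun x => ENNReal.ofReal_add_le
  exact (hle.trans_lt (ENNReal.add_lt_top.2 ⟨h.lt_top, hG.lintegral_lt_top⟩)).ne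

lemma lintegral_ofReal_add_ne_top_iff (hG : Integrable G m) :
    ∫⁻ x, ENNReal.ofReal (F x + G x) ∂m ≠ ⊤ ↔ ∫⁻ x, ENNReal.ofReal (F x) ∂m ≠ ⊤ := by
  refine ⟨fun h => ?_, lintegral_ofReal_add_ne_top hG⟩
  have := lintegral_ofReal_add_ne_top hG.neg h
  simpa using this

lemma extIntegral_add_integrable (hF : AEStronglyMeasurable F m) (hG : Integrable G m) :
    extIntegral m (fun x => F x + G x) = extIntegral m F + ((∫ x, G x ∂m : ℝ) : EReal) := by
  have hneg : ∫⁻ x, ENNReal.ofReal (-(F x + G x)) ∂m ≠ ⊤ ↔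
      ∫⁻ x, ENNReal.ofReal (-F x) ∂m ≠ ⊤ := by
    simp_rw [neg_add]
    exact lintegral_ofReal_add_ne_top_iff (F := fun x => -F x) (G := fun x => -G x) hG.neg
  have hpos := lintegral_ofReal_add_ne_top_iff (F := F) hG
  by_cases h' : ∫⁻ x, ENNReal.ofReal (-F x) ∂m = ⊤
  · rw [extIntegral_eq_bot h', extIntegral_eq_bot (not_ne_iff.1 (hneg.not.2 (not_ne_iff.2 h')))]
    simp
  by_cases h : ∫⁻ x, ENNReal.ofReal (F x) ∂m = ⊤
  · rw [extIntegral_eq_top h h', extIntegral_eq_top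
      (not_ne_iff.1 (hpos.not.2 (not_ne_iff.2 h))) (hneg.2 h')]
    simp
  have hFi := integrable_of_lintegral_ofReal_ne_top_s13 hF h h'
  have hadd := extIntegral_of_integrable (hFi.add hG)
  simp only [Pi.add_apply, integral_add hFi hG] at hadd
  rw [extIntegral_of_integrable hFi, ← EReal.coe_add, ← hadd]
  rfl

lemma extIntegral_map {T : α → β} (hT : Measurable T) {H : β → ℝ} (hH : Measurable H) :
    extIntegral (m.map T) H = extIntegral m (fun x => H (T x)) := by
  unfold extIntegral
  rw [lintegral_map hH.ennreal_ofReal hT,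
    lintegral_map (f := fun y => ENNReal.ofReal (-H y)) hH.neg.ennreal_ofReal hT]

lemma exists_integrable_le_of_lt_extIntegral [IsFiniteMeasure m] (hF : Measurable F) {t : ℝ}
    (h : (t : EReal) < extIntegral m F) :
    ∃ G : α → ℝ, Integrable G m ∧ (∀ x, G x ≤ F x) ∧ t < ∫ x, G x ∂m := by
  have hneg : ∫⁻ x, ENNReal.ofReal (-F x) ∂m ≠ ⊤ := fun h' => by
    rw [extIntegral_eq_bot h'] at h
    exact not_lt_bot h
  by_cases hpos : ∫⁻ x, ENNReal.ofReal (F x) ∂m = ⊤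
  · have hmeas : ∀ n : ℕ, Measurable fun x => min (F x) n := fun n => hF.min measurable_const
    have hnegn : ∀ n : ℕ, ∀ x, ENNReal.ofReal (-min (F x) n) = ENNReal.ofReal (-F x) := by
      intro n x
      have hn : (0 : ℝ) ≤ n := n.cast_nonneg
      rcases le_total (F x) n with hx | hx
      · rw [min_eq_left hx]
      · rw [min_eq_right hx, ENNReal.ofReal_of_nonpos (by linarith),
          ENNReal.ofReal_of_nonpos (by linarith)]
    have hint : ∀ n : ℕ, Integrable (fun x => min (F x) n) m := by
      intro n
      refine integrable_of_lintegral_ofReal_ne_top_s13 (hmeas n).aestronglyMeasurable ?_ ?_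
      · refine ne_of_lt (lt_of_le_of_lt (lintegral_mono (g := fun _ => ENNReal.ofReal n)
          fun x => ENNReal.ofReal_le_ofReal (min_le_right _ _)) ?_)
        rw [lintegral_const]
        exact ENNReal.mul_lt_top ENNReal.ofReal_lt_top (measure_lt_top _ _)
      · simp_rw [hnegn]
        exact hneg
    have hlim : Tendsto (fun n : ℕ => ∫⁻ x, ENNReal.ofReal (min (F x) n) ∂m) atTop (𝓝 ⊤) := by
      rw [← hpos]
      refine lintegral_tendsto_of_tendsto_of_monotone
        (fun n => (hmeas n).ennreal_ofReal.aemeasurable) (ae_of_all _ fun x a b hab => ?_)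
        (ae_of_all _ fun x => ?_)
      · exact ENNReal.ofReal_le_ofReal (min_le_min le_rfl (Nat.cast_le.2 hab))
      · refine tendsto_const_nhds.congr' ?_
        filter_upwards [eventually_ge_atTop ⌈F x⌉₊] with n hn
        rw [min_eq_left ((Nat.le_ceil _).trans (Nat.cast_le.2 hn))]
    set K : ℝ := (∫⁻ x, ENNReal.ofReal (-F x) ∂m).toReal
    obtain ⟨n, hn⟩ := (hlim.eventually (lt_mem_nhds
      (ENNReal.ofReal_lt_top (r := |t + K|)))).exists
    refine ⟨_, hint n, fun x => min_le_left _ _, ?_⟩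
    rw [integral_eq_lintegral_pos_part_sub_lintegral_neg_part (hint n)]
    simp_rw [hnegn]
    have := (ENNReal.ofReal_lt_iff_lt_toReal (abs_nonneg _) (hint n).lintegral_lt_top.ne).1 hn
    linarith [le_abs_self (t + K)]
  · have hFi := integrable_of_lintegral_ofReal_ne_top_s13 hF.aestronglyMeasurable hpos hneg
    rw [extIntegral_of_integrable hFi] at h
    exact ⟨F, hFi, fun _ => le_rfl, EReal.coe_lt_coe_iff.1 h⟩

lemma integral_le_extIntegral (hG : Integrable G m) (h : ∀ x, G x ≤ F x) :
    ((∫ x, G x ∂m : ℝ) : EReal) ≤ extIntegral m F :=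
  extIntegral_of_integrable hG ▸ extIntegral_mono h

end ExtIntegral

section DonskerVaradhan

variable {X : Type*} [MeasurableSpace X]

/-- Truncation of `t` to the interval `[-N, N]`. -/
def truncate (N t : ℝ) : ℝ := max (-N) (min N t)

lemma abs_truncate_le {N : ℝ} (hN : 0 ≤ N) (t : ℝ) : |truncate N t| ≤ N :=
  abs_le.2 ⟨le_max_left _ _, max_le (by linarith) (min_le_left _ _)⟩

lemma monotone_truncate (N : ℝ) : Monotone (truncate N) := fun _ _ h =>
  max_le_max le_rfl (min_le_min le_rfl h)

lemma continuous_truncate (N : ℝ) : Continuous (truncate N) := by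
  unfold truncate
  fun_prop

lemma truncate_of_abs_le {N t : ℝ} (h : |t| ≤ N) : truncate N t = t := by
  obtain ⟨h1, h2⟩ := abs_le.1 h
  rw [truncate, min_eq_right h2, max_eq_right h1]

lemma abs_truncate_sub_truncate_le (N s t : ℝ) : |truncate N s - truncate N t| ≤ |s - t| :=
  (abs_max_sub_max_le_max _ _ _ _).trans
    (max_le (by simp) ((abs_min_sub_min_le_max _ _ _ _).trans (max_le (by simp) le_rfl)))

lemma abs_truncate_le_abs {N : ℝ} (hN : 0 ≤ N) (t : ℝ) : |truncate N t| ≤ |t| := by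
  have := abs_truncate_sub_truncate_le N t 0
  rwa [truncate_of_abs_le (t := 0) (by simpa using hN), sub_zero, sub_zero] at this

lemma integrable_of_forall_abs_le {m : Measure X} [IsFiniteMeasure m] {f : X → ℝ}
    (hf : Measurable f) {N : ℝ} (hN : ∀ x, |f x| ≤ N) : Integrable f m :=
  Integrable.of_bound hf.aestronglyMeasurable N (ae_of_all _ hN)

lemma integrable_exp_of_forall_abs_le {m : Measure X} [IsFiniteMeasure m] {f : X → ℝ}
    (hf : Measurable f) {N : ℝ} (hN : ∀ x, |f x| ≤ N) : Integrable (fun x => rexp (f x)) m :=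
  integrable_of_forall_abs_le hf.exp (N := rexp N) fun x => by
    rw [abs_of_pos (exp_pos _)]
    exact exp_le_exp.2 (le_of_abs_le (hN x))

variable [TopologicalSpace X] [NormalSpace X] [BorelSpace X] {ρ m : Measure X}
  [IsProbabilityMeasure ρ] [IsFiniteMeasure m] [(ρ + m).WeaklyRegular] {C : ℝ}

lemma integral_sub_integral_exp_le_of_measurable
    (h : ∀ φ : BoundedContinuousFunction X ℝ, ∫ x, φ x ∂ρ + 1 - ∫ x, rexp (φ x) ∂m ≤ C)
    {φ : X → ℝ} (hφ : Measurable φ) {N : ℝ} (hN : ∀ x, |φ x| ≤ N) :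
    ∫ x, φ x ∂ρ + 1 - ∫ x, rexp (φ x) ∂m ≤ C := by
  have hN' : ∀ x, |φ x| ≤ max N 0 := fun x => (hN x).trans (le_max_left _ _)
  have hM0 : 0 ≤ max N 0 := le_max_right _ _
  generalize max N 0 = M at hN' hM0
  have key : ∀ δ > 0, ∫ x, φ x ∂ρ + 1 - ∫ x, rexp (φ x) ∂m ≤ C + δ * (1 + rexp M) := by
    intro δ hδ
    obtain ⟨g, hg, hgi⟩ :=
      (integrable_of_forall_abs_le (m := ρ + m) hφ hN').exists_boundedContinuous_integral_sub_le hδ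
    let g' : BoundedContinuousFunction X ℝ :=
      BoundedContinuousFunction.ofNormedAddCommGroup (fun x => truncate M (g x))
        ((continuous_truncate M).comp g.continuous) M fun x => abs_truncate_le hM0 _
    have hg'm : Measurable fun x => g' x := g'.continuous.measurable
    have hg'b : ∀ x, |g' x| ≤ M := fun x => abs_truncate_le hM0 _
    have hle : ∀ x, |φ x - g' x| ≤ ‖φ x - g x‖ := fun x => by
      rw [← truncate_of_abs_le (hN' x)]
      refine (abs_truncate_sub_truncate_le M _ _).trans ?_
      rw [truncate_of_abs_le (hN' x)]
      rfl
    have hdi : Integrable (fun x => ‖φ x - g x‖) (ρ + m) :=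
      ((integrable_of_forall_abs_le hφ hN').sub hgi).norm
    rw [integral_add_measure (hdi.mono_measure (Measure.le_add_right le_rfl))
      (hdi.mono_measure (Measure.le_add_left le_rfl))] at hg
    have hdρ : Integrable (fun x => ‖φ x - g x‖) ρ :=
      hdi.mono_measure (Measure.le_add_right le_rfl)
    have hdm : Integrable (fun x => ‖φ x - g x‖) m :=
      hdi.mono_measure (Measure.le_add_left le_rfl)
    have hρ0 : 0 ≤ ∫ x, ‖φ x - g x‖ ∂ρ := integral_nonneg fun _ => norm_nonneg _
    have hm0 : 0 ≤ ∫ x, ‖φ x - g x‖ ∂m := integral_nonneg fun _ => norm_nonneg _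
    have h1 : ∫ x, φ x ∂ρ ≤ ∫ x, g' x ∂ρ + ∫ x, ‖φ x - g x‖ ∂ρ := by
      rw [← integral_add (integrable_of_forall_abs_le hg'm hg'b) hdρ]
      refine integral_mono (integrable_of_forall_abs_le hφ hN')
        ((integrable_of_forall_abs_le hg'm hg'b).add hdρ) fun x => ?_
      have := (le_abs_self _).trans (hle x)
      linarith
    have h2 : ∫ x, rexp (g' x) ∂m ≤ ∫ x, rexp (φ x) ∂m + rexp M * ∫ x, ‖φ x - g x‖ ∂m := by
      rw [← integral_const_mul, ← integral_add (integrable_exp_of_forall_abs_le hφ hN')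
        (hdm.const_mul _)]
      refine integral_mono (integrable_exp_of_forall_abs_le hg'm hg'b)
        ((integrable_exp_of_forall_abs_le hφ hN').add (hdm.const_mul _)) fun x => ?_
      have h3 : rexp (g' x) * (1 + (φ x - g' x)) ≤ rexp (φ x) := by
        have := add_one_le_exp (φ x - g' x)
        rw [exp_sub, le_div_iff₀ (exp_pos _)] at this
        linarith
      have h4 : rexp (g' x) ≤ rexp M := exp_le_exp.2 (le_of_abs_le (hg'b x))
      have h5 := (neg_le_abs _).trans (hle x)
      have h6 : rexp (g' x) * (-(φ x - g' x)) ≤ rexp M * ‖φ x - g x‖ :=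
        (mul_le_mul_of_nonneg_left h5 (exp_pos _).le).trans
          (mul_le_mul_of_nonneg_right h4 (norm_nonneg _))
      linarith
    have h7 := h g'
    have h8 : rexp M * ∫ x, ‖φ x - g x‖ ∂m ≤ rexp M * δ :=
      mul_le_mul_of_nonneg_left (by linarith) (exp_pos _).le
    linarith
  have hpos : 0 < 1 + rexp M := by positivity
  refine le_of_forall_pos_le_add fun ε hε => ?_
  have := key (ε / (1 + rexp M)) (by positivity)
  rwa [div_mul_cancel₀ _ hpos.ne'] at this

/-- The Donsker–Varadhan inequality tested on bounded continuous functions bounds the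
relative entropy. -/
lemma llr_integrable_and_integral_le_of_forall_boundedContinuous
    (h : ∀ φ : BoundedContinuousFunction X ℝ, ∫ x, φ x ∂ρ + 1 - ∫ x, rexp (φ x) ∂m ≤ C) :
    ρ ≪ m ∧ Integrable (llr ρ m) ρ ∧ ∫ x, llr ρ m x ∂ρ ≤ C := by
  have hac : ρ ≪ m := by
    refine Measure.AbsolutelyContinuous.mk fun A hA hmA => ?_
    by_contra hρA
    have hpos : 0 < ρ.real A := ENNReal.toReal_pos hρA (measure_ne_top _ _)
    obtain ⟨n, hn⟩ := exists_nat_gt ((C + m.real Set.univ) / ρ.real A)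
    rw [div_lt_iff₀ hpos] at hn
    have := integral_sub_integral_exp_le_of_measurable h (φ := A.indicator fun _ => (n : ℝ))
      (measurable_const.indicator hA) (N := n) (fun x => by
        by_cases hx : x ∈ A <;> simp [hx])
    have hexp : ∫ x, rexp (A.indicator (fun _ => (n : ℝ)) x) ∂m = ∫ _, (1 : ℝ) ∂m := by
      refine integral_congr_ae ?_
      have hA' : ∀ᵐ x ∂m, x ∉ A := measure_eq_zero_iff_ae_notMem.1 hmA
      filter_upwards [hA'] with x hx
      simp [hx]
    rw [hexp, integral_indicator_const _ hA] at this
    simp only [integral_const, smul_eq_mul, mul_one] at this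
    linarith
  refine ⟨hac, ?_⟩
  set L := llr ρ m with hL
  have hLm : Measurable L := measurable_llr _ _
  have hgm : Measurable (ρ.rnDeriv m) := Measure.measurable_rnDeriv _ _
  have htrunc : ∀ N : ℕ, ∫ x, truncate N (L x) ∂ρ ≤ C + rexp (-N) * m.real Set.univ := by
    intro N
    have hN0 : (0 : ℝ) ≤ N := N.cast_nonneg
    set ψ : X → ℝ := fun x => if ρ.rnDeriv m x = 0 then -N else truncate N (L x) with hψ
    have hψm : Measurable ψ := Measurable.ite (hgm (measurableSet_singleton 0)) measurable_const
      ((continuous_truncate N).measurable.comp hLm)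
    have hψb : ∀ x, |ψ x| ≤ N := fun x => by
      by_cases hx : ρ.rnDeriv m x = 0
      · simp [hψ, hx]
      · simp only [hψ, hx, if_false]
        exact abs_truncate_le hN0 _
    have h1 := integral_sub_integral_exp_le_of_measurable h hψm hψb
    have h2 : ∫ x, ψ x ∂ρ = ∫ x, truncate N (L x) ∂ρ := by
      refine integral_congr_ae ?_
      filter_upwards [Measure.rnDeriv_pos hac] with x hx
      simp [hψ, hx.ne']
    have h3 : ∫ x, rexp (ψ x) ∂m ≤ ∫ x, ((ρ.rnDeriv m x).toReal + rexp (-N)) ∂m := by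
      refine integral_mono_ae (integrable_exp_of_forall_abs_le hψm hψb)
        (Measure.integrable_toReal_rnDeriv.add (integrable_const _)) ?_
      filter_upwards [ρ.rnDeriv_ne_top m] with x hx
      by_cases hx0 : ρ.rnDeriv m x = 0
      · simp [hψ, hx0]
      · have hpos : 0 < (ρ.rnDeriv m x).toReal := ENNReal.toReal_pos hx0 hx
        simp only [hψ, hx0, if_false, truncate]
        rw [exp_monotone.map_max, exp_monotone.map_min]
        refine max_le (by linarith) ((min_le_right _ _).trans ?_)
        rw [hL, llr, exp_log hpos]
        linarith [exp_pos (-(N : ℝ))]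
    rw [integral_add Measure.integrable_toReal_rnDeriv (integrable_const _),
      Measure.integral_toReal_rnDeriv hac] at h3
    simp only [integral_const, smul_eq_mul, probReal_univ] at h3
    rw [h2] at h1
    linarith
  have hneg : ∫⁻ x, ENNReal.ofReal (-L x) ∂ρ ≠ ⊤ := by
    rw [← lintegral_rnDeriv_mul hac (f := fun x => ENNReal.ofReal (-L x))
      hLm.neg.ennreal_ofReal.aemeasurable]
    refine ne_of_lt (lt_of_le_of_lt (lintegral_mono_ae (g := fun _ => 1) ?_)
      (by simp [measure_lt_top]))
    filter_upwards [ρ.rnDeriv_ne_top m] with x hx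
    rw [← ENNReal.ofReal_toReal hx, ← ENNReal.ofReal_mul ENNReal.toReal_nonneg]
    refine ENNReal.ofReal_le_one.2 ?_
    have hnn := ENNReal.toReal_nonneg (a := ρ.rnDeriv m x)
    have := InformationTheory.klFun_nonneg hnn
    rw [InformationTheory.klFun_apply] at this
    simp only [hL, llr]
    linarith
  have hle : extIntegral ρ L ≤ C := by
    by_contra hlt
    obtain ⟨G, hGi, hGL, hG⟩ := exists_integrable_le_of_lt_extIntegral hLm (not_le.1 hlt)
    have h1 : Tendsto (fun N : ℕ => ∫ x, truncate N (G x) ∂ρ) atTop (𝓝 (∫ x, G x ∂ρ)) := by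
      refine tendsto_integral_of_dominated_convergence (fun x => |G x|)
        (fun N => (continuous_truncate N).comp_aestronglyMeasurable hGi.1) hGi.abs
        (fun N => ae_of_all _ fun x => abs_truncate_le_abs N.cast_nonneg _)
        (ae_of_all _ fun x => tendsto_const_nhds.congr' ?_)
      filter_upwards [eventually_ge_atTop ⌈|G x|⌉₊] with n hn
      exact (truncate_of_abs_le ((Nat.le_ceil _).trans (Nat.cast_le.2 hn))).symm
    have h2 : Tendsto (fun N : ℕ => C + rexp (-N) * m.real Set.univ) atTop
        (𝓝 (C + 0 * m.real Set.univ)) :=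
      ((tendsto_exp_neg_atTop_nhds_zero.comp tendsto_natCast_atTop_atTop).mul_const _).const_add _
    have h3 := le_of_tendsto_of_tendsto' h1 h2 fun N => by
      refine (integral_mono ?_ ?_ fun x => monotone_truncate N (hGL x)).trans (htrunc N)
      · exact Integrable.of_bound ((continuous_truncate N).comp_aestronglyMeasurable hGi.1) N
          (ae_of_all _ fun x => abs_truncate_le N.cast_nonneg _)
      · exact integrable_of_forall_abs_le ((continuous_truncate N).measurable.comp hLm)
          (N := N) fun x => abs_truncate_le N.cast_nonneg _
    linarith
  have hpos : ∫⁻ x, ENNReal.ofReal (L x) ∂ρ ≠ ⊤ := fun h' => by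
    rw [extIntegral_eq_top h' hneg] at hle
    exact absurd hle (by simp)
  have hLi := integrable_of_lintegral_ofReal_ne_top_s13 hLm.aestronglyMeasurable hpos hneg
  rw [extIntegral_of_integrable hLi] at hle
  exact ⟨hLi, EReal.coe_le_coe_iff.1 hle⟩

end DonskerVaradhan

section Entropy

variable {d : ℕ} {ρ : Measure (Ed d)}

/-- The integrand `f ln f` of the entropy, where `f` is the density of `ρ`. -/
def entropyIntegrand (ρ : Measure (Ed d)) (x : Ed d) : ℝ :=
  (ρ.rnDeriv volume x).toReal * Real.log (ρ.rnDeriv volume x).toReal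

lemma measurable_entropyIntegrand : Measurable (entropyIntegrand ρ) := by
  have : Measurable fun x => (ρ.rnDeriv volume x).toReal :=
    (Measure.measurable_rnDeriv _ _).ennreal_toReal
  exact this.mul this.log

lemma entropy_of_ac (h : ρ ≪ volume) : entropy ρ = extIntegral volume (entropyIntegrand ρ) :=
  if_pos h

lemma entropy_of_not_ac (h : ¬ ρ ≪ volume) : entropy ρ = ⊤ := if_neg h

lemma mul_sub_exp_le_mul_log {a : ℝ} (ha : 0 ≤ a) (t : ℝ) :
    a * t - rexp (t - 1) ≤ a * Real.log a := by
  rcases ha.eq_or_lt with rfl | ha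
  · simpa using (exp_pos _).le
  · have h := add_one_le_exp (t - 1 - Real.log a)
    rw [exp_sub, exp_log ha, le_div_iff₀ ha] at h
    linarith

lemma integrable_exp_neg_mul_norm {ε : ℝ} (hε : 0 < ε) :
    Integrable (fun x : Ed d => rexp (-(ε * ‖x‖))) := by
  have hint : Integrable (fun x : Ed d => (1 + ‖x‖) ^ (-((d + 1 : ℕ) : ℝ))) :=
    integrable_one_add_norm (by simp)
  refine (hint.const_mul (rexp ε * (d + 1).factorial / ε ^ (d + 1))).mono'
    (by fun_prop) (ae_of_all _ fun x => ?_)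
  have hx : 0 < 1 + ‖x‖ := by positivity
  rw [Real.norm_of_nonneg (exp_pos _).le, rpow_neg hx.le, rpow_natCast]
  have h := pow_div_factorial_le_exp (ε * (1 + ‖x‖)) (by positivity) (d + 1)
  rw [mul_add, mul_one, exp_add, div_le_iff₀ (by positivity), ← mul_one_add, mul_pow] at h
  rw [exp_neg, div_mul_eq_mul_div, le_div_iff₀ (by positivity), ← div_eq_mul_inv,
    le_div_iff₀ (by positivity), mul_assoc, inv_mul_le_iff₀ (exp_pos _)]
  linarith

/-- The easy half of the variational formula for the entropy. -/
lemma integral_sub_integral_exp_le_entropy [IsProbabilityMeasure ρ] {φ : Ed d → ℝ}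
    (hφ : Integrable φ ρ) (hexp : Integrable (fun x => rexp (φ x - 1))) :
    ((∫ x, φ x ∂ρ - ∫ x, rexp (φ x - 1) : ℝ) : EReal) ≤ entropy ρ := by
  by_cases hac : ρ ≪ volume
  · rw [entropy_of_ac hac, ← integral_rnDeriv_smul hac]
    have h1 := (integrable_rnDeriv_smul_iff hac).2 hφ
    rw [← integral_sub h1 hexp]
    exact integral_le_extIntegral (h1.sub hexp) fun x =>
      mul_sub_exp_le_mul_log ENNReal.toReal_nonneg _
  · simp [entropy_of_not_ac hac]

/-- The converse half of the variational formula for the entropy. -/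
lemma entropy_le_of_forall_boundedContinuous [IsProbabilityMeasure ρ] (hρ : FirstMoment ρ)
    {ε C : ℝ} (hε : 0 < ε) (h : ∀ φ : BoundedContinuousFunction (Ed d) ℝ,
      ∫ x, φ x ∂ρ - ∫ x, rexp (φ x - ε * ‖x‖ - 1) ≤ C) : entropy ρ ≤ C := by
  have hZi := integrable_exp_neg_mul_norm (d := d) hε
  set Z : ℝ := ∫ x : Ed d, rexp (-(ε * ‖x‖)) with hZ
  have hZpos : 0 < Z := integral_exp_pos hZi
  have := isProbabilityMeasure_tilted hZi
  have key := llr_integrable_and_integral_le_of_forall_boundedContinuous (ρ := ρ)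
    (m := (volume : Measure (Ed d)).tilted fun x => -(ε * ‖x‖)) (C := C + Real.log Z) (by
      intro φ
      have h1 := h (φ + BoundedContinuousFunction.const (Ed d) (1 - Real.log Z))
      have h2 : ∫ x, (φ + BoundedContinuousFunction.const (Ed d) (1 - Real.log Z)) x ∂ρ
          = ∫ x, φ x ∂ρ + (1 - Real.log Z) := by
        simp only [BoundedContinuousFunction.add_apply, BoundedContinuousFunction.const_apply]
        rw [integral_add (φ.integrable _) (integrable_const _)]
        simp
      have h3 : ∫ x, rexp (φ x) ∂(volume : Measure (Ed d)).tilted (fun x => -(ε * ‖x‖))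
          = ∫ x, rexp ((φ + BoundedContinuousFunction.const (Ed d) (1 - Real.log Z)) x
            - ε * ‖x‖ - 1) := by
        rw [integral_tilted]
        refine integral_congr_ae (ae_of_all _ fun x => ?_)
        simp only [BoundedContinuousFunction.add_apply, BoundedContinuousFunction.const_apply,
          smul_eq_mul]
        rw [← hZ, show φ x + (1 - Real.log Z) - ε * ‖x‖ - 1
          = -(ε * ‖x‖) - Real.log Z + φ x by ring, exp_add, exp_sub, exp_log hZpos]
      rw [h2] at h1
      rw [h3]
      linarith)
  obtain ⟨hac', hLi, hL⟩ := key
  have hac : ρ ≪ volume := hac'.trans (tilted_absolutelyContinuous _ _)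
  have hllr := llr_tilted_right hac hZi
  have heq : llr ρ volume =ᵐ[ρ] fun x =>
      llr ρ ((volume : Measure (Ed d)).tilted fun x => -(ε * ‖x‖)) x - (ε * ‖x‖ + Real.log Z) := by
    filter_upwards [hllr] with x hx
    rw [hx]
    ring
  have hni : Integrable (fun x : Ed d => ε * ‖x‖ + Real.log Z) ρ :=
    (hρ.const_mul ε).add (integrable_const _)
  have hlogi : Integrable (llr ρ volume) ρ := (hLi.sub hni).congr heq.symm
  have hfi : Integrable (entropyIntegrand ρ) := (integrable_rnDeriv_smul_iff hac).2 hlogi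
  have hent : ∫ x, entropyIntegrand ρ x = ∫ x, llr ρ volume x ∂ρ := integral_rnDeriv_smul hac
  rw [entropy_of_ac hac, extIntegral_of_integrable hfi, EReal.coe_le_coe_iff, hent,
    integral_congr_ae heq, integral_sub hLi hni, integral_add (hρ.const_mul ε) (integrable_const _),
    integral_const_mul]
  have : 0 ≤ ∫ x, ‖x‖ ∂ρ := integral_nonneg fun _ => norm_nonneg _
  simp only [integral_const, probReal_univ, smul_eq_mul, one_mul]
  nlinarith

lemma integrable_exp_boundedContinuous_sub {ε : ℝ} (hε : 0 < ε)
    (φ : BoundedContinuousFunction (Ed d) ℝ) :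
    Integrable (fun x => rexp (φ x - ε * ‖x‖ - 1)) := by
  refine ((integrable_exp_neg_mul_norm hε).const_mul (rexp ‖φ‖)).mono'
    (by have := φ.continuous; fun_prop) (ae_of_all _ fun x => ?_)
  rw [Real.norm_of_nonneg (exp_pos _).le, ← exp_add]
  have := (le_abs_self _).trans (φ.norm_coe_le_norm x)
  exact exp_le_exp.2 (by linarith)

/-- Lower semicontinuity of the entropy along weakly converging families with uniformly bounded
first moments. -/
lemma entropy_le_of_tendsto {ι : Type*} {l : Filter ι} [l.NeBot] {ρs : ι → Measure (Ed d)}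
    [∀ i, IsProbabilityMeasure (ρs i)] [IsProbabilityMeasure ρ] (hρ : FirstMoment ρ)
    (hρs : ∀ i, FirstMoment (ρs i))
    (hlim : ∀ φ : BoundedContinuousFunction (Ed d) ℝ,
      Tendsto (fun i => ∫ x, φ x ∂(ρs i)) l (𝓝 (∫ x, φ x ∂ρ)))
    {M : ℝ} (hM : ∀ i, ∫ x, ‖x‖ ∂(ρs i) ≤ M) {s : ℝ} (hs : ∃ᶠ i in l, entropy (ρs i) ≤ s) :
    entropy ρ ≤ s := by
  have key : ∀ ε : ℝ, 0 < ε → entropy ρ ≤ ((s + ε * M : ℝ) : EReal) := by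
    intro ε hε
    refine entropy_le_of_forall_boundedContinuous hρ hε fun φ => ?_
    refine le_of_tendsto_of_frequently ((hlim φ).sub_const _) (hs.mono fun i hi => ?_)
    have h1 := integral_sub_integral_exp_le_entropy (ρ := ρs i) (φ := fun x => φ x - ε * ‖x‖)
      ((φ.integrable _).sub ((hρs i).const_mul ε)) (integrable_exp_boundedContinuous_sub hε φ)
    have h2 := EReal.coe_le_coe_iff.1 (h1.trans hi)
    rw [integral_sub (φ.integrable _) ((hρs i).const_mul ε), integral_const_mul] at h2
    nlinarith [hM i]
  have hlim' : Tendsto (fun ε : ℝ => ((s + ε * M : ℝ) : EReal)) (𝓝[>] 0) (𝓝 (s : EReal)) := by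
    have : Tendsto (fun ε : ℝ => s + ε * M) (𝓝 0) (𝓝 (s + 0 * M)) :=
      (by fun_prop : Continuous fun ε : ℝ => s + ε * M).tendsto 0
    rw [zero_mul, add_zero] at this
    exact EReal.tendsto_coe.2 (this.mono_left nhdsWithin_le_nhds)
  exact ge_of_tendsto hlim' (eventually_nhdsWithin_of_forall fun ε hε => key ε hε)

lemma entropy_map_add_right [IsProbabilityMeasure ρ] (b : Ed d) :
    entropy (ρ.map (· + b)) = entropy ρ := by
  have hmp := measurePreserving_add_right (volume : Measure (Ed d)) b
  have hemb : MeasurableEmbedding fun x : Ed d => x + b :=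
    (Homeomorph.addRight b).measurableEmbedding
  have hiff : ρ.map (· + b) ≪ volume ↔ ρ ≪ volume := by
    constructor
    · intro h
      have := h.map (f := (· + (-b))) (by fun_prop)
      rwa [Measure.map_map (by fun_prop) (by fun_prop), (measurePreserving_add_right _ (-b)).map_eq,
        show ((fun x : Ed d => x + -b) ∘ fun x => x + b) = id by ext; simp, Measure.map_id] at this
    · intro h
      have := h.map (f := (· + b)) (by fun_prop)
      rwa [hmp.map_eq] at this
  by_cases hac : ρ ≪ volume
  · rw [entropy_of_ac hac, entropy_of_ac (hiff.2 hac)]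
    conv_lhs => rw [← hmp.map_eq]
    rw [extIntegral_map (by fun_prop) measurable_entropyIntegrand]
    refine extIntegral_congr_ae ?_
    have h := hemb.rnDeriv_map ρ volume
    rw [hmp.map_eq] at h
    filter_upwards [h] with x hx
    simp only [entropyIntegrand, hx]
  · rw [entropy_of_not_ac hac, entropy_of_not_ac (hiff.not.2 hac)]

end Entropy

section RealDensity

variable {α E : Type*} [MeasurableSpace α] [NormedAddCommGroup E] [NormedSpace ℝ E]
  {m : Measure α} {g : α → ℝ} {f : α → E}

/-- The measure with density `g` (set to `0` where `g` is negative) with respect to `m`. -/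
def realDensity (m : Measure α) (g : α → ℝ) : Measure α :=
  m.withDensity fun x => ENNReal.ofReal (g x)

lemma integral_realDensity (hg : Measurable g) (h0 : ∀ x, 0 ≤ g x) :
    ∫ x, f x ∂(realDensity m g) = ∫ x, g x • f x ∂m := by
  rw [realDensity, integral_withDensity_eq_integral_toReal_smul hg.ennreal_ofReal (by simp)]
  simp_rw [ENNReal.toReal_ofReal (h0 _)]

lemma integrable_bounded_smul (hf : Integrable f m) (hg : Measurable g)
    (h0 : ∀ x, 0 ≤ g x) {C : ℝ} (hC : ∀ x, g x ≤ C) : Integrable (fun x => g x • f x) m :=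
  hf.bdd_smul C hg.aestronglyMeasurable
    (ae_of_all _ fun x => by rw [Real.norm_of_nonneg (h0 x)]; exact hC x)

lemma integrable_realDensity (hf : Integrable f m) (hg : Measurable g)
    (h0 : ∀ x, 0 ≤ g x) {C : ℝ} (hC : ∀ x, g x ≤ C) : Integrable f (realDensity m g) := by
  rw [realDensity, integrable_withDensity_iff_integrable_smul' hg.ennreal_ofReal (by simp)]
  simp_rw [ENNReal.toReal_ofReal (h0 _)]
  exact integrable_bounded_smul hf hg h0 hC

lemma realDensity_univ (hi : Integrable g m) (h0 : ∀ x, 0 ≤ g x) :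
    realDensity m g Set.univ = ENNReal.ofReal (∫ x, g x ∂m) := by
  rw [realDensity, withDensity_apply _ MeasurableSet.univ, Measure.restrict_univ,
    ofReal_integral_eq_lintegral_ofReal hi (ae_of_all _ h0)]

lemma isFiniteMeasure_realDensity (hi : Integrable g m) (h0 : ∀ x, 0 ≤ g x) :
    IsFiniteMeasure (realDensity m g) :=
  ⟨by rw [realDensity_univ hi h0]; exact ENNReal.ofReal_lt_top⟩

lemma realDensity_sum {ι : Type*} (s : Finset ι) {g : ι → α → ℝ} (hg : ∀ i, Measurable (g i))
    (h0 : ∀ i x, 0 ≤ g i x) :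
    realDensity m (fun x => ∑ i ∈ s, g i x) = ∑ i ∈ s, realDensity m (g i) := by
  ext A hA
  simp only [realDensity, Measure.finsetSum_apply, withDensity_apply _ hA]
  rw [← lintegral_finsetSum _ fun i _ => (hg i).ennreal_ofReal]
  exact lintegral_congr fun x => ENNReal.ofReal_sum_of_nonneg fun i _ => h0 i x

lemma realDensity_add {g h : α → ℝ} (hg : Measurable g)
    (h0 : ∀ x, 0 ≤ g x) (h0' : ∀ x, 0 ≤ h x) :
    realDensity m (fun x => g x + h x) = realDensity m g + realDensity m h := by
  rw [realDensity, realDensity, realDensity, ← withDensity_add_left hg.ennreal_ofReal]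
  congr 1
  ext x
  exact ENNReal.ofReal_add (h0 x) (h0' x)

lemma realDensity_const_mul (hg : Measurable g) {c : ℝ} (hc : 0 ≤ c) :
    realDensity m (fun x => c * g x) = ENNReal.ofReal c • realDensity m g := by
  rw [realDensity, realDensity, ← withDensity_smul _ hg.ennreal_ofReal]
  congr 1
  ext x
  exact ENNReal.ofReal_mul hc

lemma realDensity_one : realDensity m (fun _ => 1) = m := by
  simp [realDensity]

end RealDensity

section Transport

variable {d : ℕ} {ρ μ : Measure (Ed d)}

lemma FirstMoment.integrable_id (h : FirstMoment ρ) : Integrable (fun x => x) ρ :=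
  (integrable_norm_iff (by fun_prop)).1 h

lemma integrable_inner_prod_s13 {A B : Measure (Ed d)} [IsFiniteMeasure A] [IsFiniteMeasure B]
    (hA : Integrable (fun x => x) A) (hB : Integrable (fun x => x) B) :
    Integrable (fun p : Ed d × Ed d => (⟪p.1, p.2⟫ : ℝ)) (A.prod B) :=
  hA.op_fst_snd (op := fun x y : Ed d => (⟪x, y⟫ : ℝ)) (by fun_prop)
    ⟨1, fun x y => by simpa using norm_inner_le_norm (𝕜 := ℝ) x y⟩ hB

lemma integral_inner_prod {A B : Measure (Ed d)} [IsFiniteMeasure A] [IsFiniteMeasure B]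
    (hA : Integrable (fun x => x) A) (hB : Integrable (fun x => x) B) :
    ∫ p : Ed d × Ed d, (⟪p.1, p.2⟫ : ℝ) ∂(A.prod B) = (⟪∫ x, x ∂A, ∫ y, y ∂B⟫ : ℝ) :=
  integral_prod_bilin (innerSL ℝ) hA hB

/-- The lower bound on the maximal correlation given by the plan
`∑ i, (g i • ρ) ⊗ ν i + ((1 - ∑ i, ‖ν i‖ g i) • ρ) ⊗ μ`. -/
lemma sum_inner_le_maxCorr [IsProbabilityMeasure ρ] [IsProbabilityMeasure μ]
    (hρ : FirstMoment ρ) (hμ : FirstMoment μ) (hμc : Centered μ) {ι : Type*} [Fintype ι]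
    {g : ι → Ed d → ℝ} (hg : ∀ i, Measurable (g i)) (h0 : ∀ i x, 0 ≤ g i x)
    {C : ι → ℝ} (hC : ∀ i x, g i x ≤ C i) {ν : ι → Measure (Ed d)} [∀ i, IsFiniteMeasure (ν i)]
    (hν : ∀ i, Integrable (fun x => x) (ν i))
    (hsum : ∀ x, ∑ i, (ν i).real Set.univ * g i x ≤ 1)
    {θ : ℝ} (hθ0 : 0 ≤ θ)
    (hθ : ∑ i, ENNReal.ofReal (∫ x, g i x ∂ρ) • ν i = ENNReal.ofReal θ • μ) :
    ((∑ i, ⟪∫ x, g i x • x ∂ρ, ∫ y, y ∂(ν i)⟫ : ℝ) : EReal) ≤ maxCorr ρ μ := by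
  set h : Ed d → ℝ := fun x => 1 - ∑ i, (ν i).real Set.univ * g i x with hh
  have hhm : Measurable h := by fun_prop
  have hh0 : ∀ x, 0 ≤ h x := fun x => sub_nonneg.2 (hsum x)
  have hh1 : ∀ x, h x ≤ 1 := fun x =>
    sub_le_self _ (Finset.sum_nonneg fun i _ => mul_nonneg measureReal_nonneg (h0 i x))
  have hgi : ∀ i, Integrable (g i) ρ := fun i =>
    Integrable.of_bound (hg i).aestronglyMeasurable (C i)
    (ae_of_all _ fun x => by rw [Real.norm_of_nonneg (h0 i x)]; exact hC i x)
  have hgi0 : ∀ i, 0 ≤ ∫ x, g i x ∂ρ := fun i => integral_nonneg (h0 i)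
  have hhi : Integrable h ρ := Integrable.of_bound hhm.aestronglyMeasurable 1
    (ae_of_all _ fun x => by rw [Real.norm_of_nonneg (hh0 x)]; exact hh1 x)
  have hmass : ∑ i, (∫ x, g i x ∂ρ) * (ν i).real Set.univ = θ := by
    have := congrArg (fun m : Measure (Ed d) => (m Set.univ).toReal) hθ
    simp only [Measure.finsetSum_apply, Measure.smul_apply, smul_eq_mul, measure_univ, mul_one,
      ENNReal.toReal_ofReal hθ0] at this
    rw [ENNReal.toReal_sum fun i _ => ENNReal.mul_ne_top ENNReal.ofReal_ne_top
      (measure_ne_top _ _)] at this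
    simpa [ENNReal.toReal_mul, ENNReal.toReal_ofReal (hgi0 _), measureReal_def] using this
  have hhint : ∫ x, h x ∂ρ = 1 - θ := by
    rw [hh, integral_sub (integrable_const _)
      (integrable_finsetSum _ fun i _ => (hgi i).const_mul _),
      integral_finsetSum _ fun i _ => (hgi i).const_mul _, ← hmass]
    simp only [integral_const_mul, integral_const, probReal_univ, smul_eq_mul, one_mul]
    simp only [mul_comm]
  have := fun i => isFiniteMeasure_realDensity (hgi i) (h0 i)
  have := isFiniteMeasure_realDensity hhi hh0
  have hgI : ∀ i, Integrable (fun x => x) (realDensity ρ (g i)) := fun i =>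
    integrable_realDensity hρ.integrable_id (hg i) (h0 i) (hC i)
  have hhI : Integrable (fun x => x) (realDensity ρ h) :=
    integrable_realDensity hρ.integrable_id hhm hh0 hh1
  set Γ : Measure (Ed d × Ed d) :=
    ∑ i, (realDensity ρ (g i)).prod (ν i) + (realDensity ρ h).prod μ with hΓ
  have hfst : Γ.fst = ρ := by
    rw [hΓ, Measure.fst, Measure.map_add _ _ measurable_fst,
      Measure.map_finset_sum' measurable_fst.aemeasurable]
    simp only [Measure.map_fst_prod, measure_univ, one_smul]
    have : ∀ i, ν i Set.univ • realDensity ρ (g i)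
        = realDensity ρ (fun x => (ν i).real Set.univ * g i x) := fun i => by
      rw [realDensity_const_mul (hg i) measureReal_nonneg, ofReal_measureReal]
    simp_rw [this]
    rw [← realDensity_sum _ (fun i => by fun_prop)
      fun i x => mul_nonneg measureReal_nonneg (h0 i x), ← realDensity_add (by fun_prop)
      (fun x => Finset.sum_nonneg fun i _ => mul_nonneg measureReal_nonneg (h0 i x)) hh0]
    simp [hh, realDensity_one]
  have hsnd : Γ.snd = μ := by
    rw [hΓ, Measure.snd, Measure.map_add _ _ measurable_snd,
      Measure.map_finset_sum' measurable_snd.aemeasurable]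
    simp only [Measure.map_snd_prod]
    simp_rw [realDensity_univ (hgi _) (h0 _)]
    have hθ1 : 0 ≤ 1 - θ := hhint ▸ integral_nonneg hh0
    rw [hθ, realDensity_univ hhi hh0, hhint, ← add_smul, ← ENNReal.ofReal_add hθ0 hθ1]
    simp
  have hprob : IsProbabilityMeasure Γ := ⟨by rw [← Measure.fst_univ, hfst, measure_univ]⟩
  have hint1 : ∀ i ∈ Finset.univ, Integrable (fun p : Ed d × Ed d => (⟪p.1, p.2⟫ : ℝ))
      ((realDensity ρ (g i)).prod (ν i)) := fun i _ => integrable_inner_prod_s13 (hgI i) (hν i)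
  have hint2 := integrable_inner_prod_s13 hhI hμ.integrable_id
  have hint := (integrable_finsetSum_measure.2 hint1).add_measure hint2
  refine le_trans (le_of_eq ?_) (le_iSup₂ (f := fun γ _ => pairInt γ) Γ ⟨hprob, hfst, hsnd⟩)
  change _ = extIntegral Γ _
  rw [extIntegral_of_integrable hint, integral_add_measure (integrable_finsetSum_measure.2 hint1)
    hint2, integral_finsetSum_measure hint1, integral_inner_prod hhI hμ.integrable_id]
  have hc : ∫ y, y ∂μ = 0 := hμc
  simp_rw [hc, integral_inner_prod (hgI _) (hν _), integral_realDensity (hg _) (h0 _)]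
  simp

lemma FirstMoment.integrable_smul (hρ : FirstMoment ρ) {s : Ed d → ℝ} (hs : Measurable s)
    (hs1 : ∀ x, |s x| ≤ 1) : Integrable (fun x => s x • x) ρ :=
  hρ.integrable_id.bdd_smul 1 hs.aestronglyMeasurable (ae_of_all _ hs1)

lemma inner_integral_smul_le_maxCorr [IsProbabilityMeasure ρ] [IsProbabilityMeasure μ]
    (hρ : FirstMoment ρ) (hμ : FirstMoment μ) (hμc : Centered μ) {h k : Ed d → ℝ}
    (hh : Measurable h) (hk : Measurable k) (hh1 : ∀ x, |h x| ≤ 1) (hk1 : ∀ x, |k x| ≤ 1)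
    (hh0 : ∫ x, h x ∂ρ = 0) (hk0 : ∫ y, k y ∂μ = 0) :
    ((⟪∫ x, h x • x ∂ρ, ∫ y, k y • y ∂μ⟫ : ℝ) : EReal) ≤ maxCorr ρ μ := by
  set σ : Bool → ℝ := fun i => if i then 1 else -1 with hσ
  have hσ1 : ∀ i, |σ i| = 1 := by rintro (_ | _) <;> simp [hσ]
  have hb : ∀ i t, |t| ≤ 1 → 0 ≤ 1 + σ i * t ∧ 1 + σ i * t ≤ 2 := fun i t ht => by
    have : |σ i * t| ≤ 1 := by rwa [abs_mul, hσ1, one_mul]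
    constructor <;> linarith [abs_le.1 this]
  have hhi : Integrable h ρ := Integrable.of_bound hh.aestronglyMeasurable 1 (ae_of_all _ hh1)
  have hki : Integrable k μ := Integrable.of_bound hk.aestronglyMeasurable 1 (ae_of_all _ hk1)
  set g : Bool → Ed d → ℝ := fun i x => 1 / 2 * (1 + σ i * h x) with hgdef
  set q : Bool → Ed d → ℝ := fun i y => 1 + σ i * k y with hqdef
  have hg : ∀ i, Measurable (g i) := fun i => by fun_prop
  have hq : ∀ i, Measurable (q i) := fun i => by fun_prop
  have hg0 : ∀ i x, 0 ≤ g i x := fun i x => mul_nonneg (by norm_num) (hb i _ (hh1 x)).1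
  have hg1 : ∀ i x, g i x ≤ 1 := fun i x => by
    have := (hb i _ (hh1 x)).2
    simp only [hgdef]
    linarith
  have hq0 : ∀ i x, 0 ≤ q i x := fun i x => (hb i _ (hk1 x)).1
  have hq2 : ∀ i x, q i x ≤ 2 := fun i x => (hb i _ (hk1 x)).2
  have hqi : ∀ i, Integrable (q i) μ := fun i => (integrable_const _).add (hki.const_mul _)
  have hqI : ∀ i, ∫ y, q i y ∂μ = 1 := fun i => by
    rw [hqdef, integral_add (integrable_const _) (hki.const_mul _), integral_const_mul, hk0]
    simp
  have hgI : ∀ i, ∫ x, g i x ∂ρ = 1 / 2 := fun i => by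
    rw [hgdef, integral_const_mul, integral_add (integrable_const _) (hhi.const_mul _),
      integral_const_mul, hh0]
    simp
  have := fun i => isFiniteMeasure_realDensity (hqi i) (hq0 i)
  have key := sum_inner_le_maxCorr hρ hμ hμc hg hg0 (C := 1) hg1 (ν := fun i => realDensity μ (q i))
    (fun i => integrable_realDensity hμ.integrable_id (hq i) (hq0 i) (hq2 i)) (fun x => by
      simp only [measureReal_def, realDensity_univ (hqi _) (hq0 _), hqI]
      simp [hgdef, hσ]
      linarith) zero_le_one (by
      simp_rw [hgI, ← realDensity_const_mul (hq _) one_half_pos.le]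
      rw [← realDensity_sum _ (fun i => (hq i).const_mul _)
        fun i x => mul_nonneg one_half_pos.le (hq0 i x), ENNReal.ofReal_one, one_smul]
      convert realDensity_one using 2
      ext y
      simp [hqdef, hσ]
      ring)
  refine le_trans (le_of_eq ?_) key
  have hx := hρ.integrable_id
  have hy := hμ.integrable_id
  have hx' : Integrable (fun x : Ed d => (1 / 2 : ℝ) • x) ρ := hx.smul (1 / 2 : ℝ)
  have hhx : ∀ i, Integrable (fun x => (1 / 2 : ℝ) • σ i • h x • x) ρ := fun i =>
    ((hρ.integrable_smul hh hh1).smul (σ i)).smul (1 / 2 : ℝ)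
  have hky : ∀ i, Integrable (fun y => σ i • k y • y) μ := fun i =>
    (hμ.integrable_smul hk hk1).smul (σ i)
  have e1 : ∀ i, ∫ x, g i x • x ∂ρ
      = (1 / 2 : ℝ) • (∫ x, x ∂ρ) + (1 / 2 : ℝ) • σ i • ∫ x, h x • x ∂ρ := fun i => by
    simp only [hgdef, mul_smul, add_smul, one_smul, smul_add]
    rw [integral_add hx' (hhx i), integral_smul, integral_smul, integral_smul]
  have e2 : ∀ i, ∫ y, y ∂(realDensity μ (q i)) = σ i • ∫ y, k y • y ∂μ := fun i => by
    rw [integral_realDensity (hq i) (hq0 i)]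
    simp only [hqdef, mul_smul, add_smul, one_smul]
    have hc : ∫ y, y ∂μ = 0 := hμc
    rw [integral_add hy (hky i), integral_smul, hc, zero_add]
  simp_rw [e1, e2]
  congr 1
  simp [hσ, inner_add_left, inner_smul_left, inner_neg_right, inner_neg_left]
  ring

/-- The sign of a real number, with the convention that `0` has sign `1`. -/
def signum (t : ℝ) : ℝ := if 0 ≤ t then 1 else -1

lemma measurable_signum : Measurable signum :=
  Measurable.ite measurableSet_Ici measurable_const measurable_const

lemma abs_signum (t : ℝ) : |signum t| = 1 := by
  unfold signum; split_ifs <;> simp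

lemma signum_mul_self (t : ℝ) : signum t * t = |t| := by
  unfold signum; split_ifs with h
  · rw [abs_of_nonneg h, one_mul]
  · rw [abs_of_neg (not_le.1 h), neg_one_mul]

lemma exists_centered_half [IsProbabilityMeasure ρ] (hρ : FirstMoment ρ) (hc : Centered ρ)
    {s : Ed d → ℝ} (hs : Measurable s) (hs1 : ∀ x, |s x| ≤ 1) :
    ∃ h : Ed d → ℝ, Measurable h ∧ (∀ x, |h x| ≤ 1) ∧ ∫ x, h x ∂ρ = 0 ∧
      ∫ x, h x • x ∂ρ = (1 / 2 : ℝ) • ∫ x, s x • x ∂ρ := by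
  have hsi : Integrable s ρ := Integrable.of_bound hs.aestronglyMeasurable 1 (ae_of_all _ hs1)
  have hx : Integrable (fun x : Ed d => (∫ x, s x ∂ρ) • x) ρ := hρ.integrable_id.smul (∫ x, s x ∂ρ)
  have hmean : |∫ x, s x ∂ρ| ≤ 1 := by
    have := norm_integral_le_of_norm_le_const (μ := ρ) (f := s) (C := 1) (ae_of_all _ hs1)
    simpa using this
  refine ⟨fun x => (1 / 2 : ℝ) * (s x - ∫ x, s x ∂ρ), by fun_prop, fun x => ?_, ?_, ?_⟩
  · rw [abs_mul, abs_of_pos one_half_pos]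
    have := abs_sub (s x) (∫ x, s x ∂ρ)
    linarith [hs1 x]
  · rw [integral_const_mul, integral_sub hsi (integrable_const _)]
    simp
  · have hc' : ∫ x, x ∂ρ = 0 := hc
    simp only [mul_smul, sub_smul]
    rw [integral_smul, integral_sub (hρ.integrable_smul hs hs1) hx, integral_smul, hc',
      smul_zero, sub_zero]

lemma integral_abs_inner_le_maxCorr [IsProbabilityMeasure ρ] [IsProbabilityMeasure μ]
    (hρ : FirstMoment ρ) (hρc : Centered ρ) (hμ : FirstMoment μ) (hμc : Centered μ)
    {s : Ed d → ℝ} (hs : Measurable s) (hs1 : ∀ x, |s x| ≤ 1) :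
    ((1 / 4 * ∫ y, |(⟪∫ x, s x • x ∂ρ, y⟫ : ℝ)| ∂μ : ℝ) : EReal) ≤ maxCorr ρ μ := by
  obtain ⟨h, hh, hh1, hh0, hhx⟩ := exists_centered_half hρ hρc hs hs1
  set v := ∫ x, s x • x ∂ρ
  have hm : Measurable fun y : Ed d => signum (⟪v, y⟫ : ℝ) := measurable_signum.comp (by fun_prop)
  have hm1 : ∀ y : Ed d, |signum (⟪v, y⟫ : ℝ)| ≤ 1 := fun y => (abs_signum _).le
  obtain ⟨k, hk, hk1, hk0, hky⟩ := exists_centered_half hμ hμc hm hm1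
  refine le_trans (le_of_eq ?_) (inner_integral_smul_le_maxCorr hρ hμ hμc hh hk hh1 hk1 hh0 hk0)
  rw [hhx, hky, inner_smul_left, inner_smul_right,
    ← integral_inner (hμ.integrable_smul hm hm1)]
  simp_rw [inner_smul_right, signum_mul_self]
  congr 1
  simp
  ring

lemma exists_pos_forall_le_integral_abs_inner (hd : 1 ≤ d) [IsProbabilityMeasure μ]
    (hμ : FirstMoment μ)
    (hμH : ¬ ∃ e : Ed d, ∃ ℓ : ℝ, ‖e‖ = 1 ∧ μ {y | (⟪y, e⟫ : ℝ) = ℓ} = 1) :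
    ∃ c : ℝ, 0 < c ∧ ∀ v : Ed d, c * ‖v‖ ≤ ∫ y, |(⟪v, y⟫ : ℝ)| ∂μ := by
  have hi : ∀ v : Ed d, Integrable (fun y : Ed d => |(⟪v, y⟫ : ℝ)|) μ := fun v =>
    (hμ.integrable_id.const_inner v).abs
  have hcont : ContinuousOn (fun v : Ed d => ∫ y, |(⟪v, y⟫ : ℝ)| ∂μ) (Metric.sphere 0 1) := by
    refine continuousOn_of_dominated (bound := fun y => ‖y‖)
      (fun v _ => (hi v).aestronglyMeasurable) (fun v hv => ae_of_all _ fun y => ?_) hμ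
      (ae_of_all _ fun y => by fun_prop)
    have := abs_real_inner_le_norm v y
    rw [mem_sphere_zero_iff_norm.1 hv, one_mul] at this
    simpa using this
  have : Nonempty (Fin d) := ⟨⟨0, hd⟩⟩
  obtain ⟨e, he, hmin⟩ := (isCompact_sphere (0 : Ed d) 1).exists_isMinOn
    (NormedSpace.sphere_nonempty.2 zero_le_one) hcont
  refine ⟨∫ y, |(⟪e, y⟫ : ℝ)| ∂μ, ?_, fun v => ?_⟩
  · refine (integral_nonneg fun y => abs_nonneg _).lt_of_ne fun h0 => hμH ⟨e, 0,
      mem_sphere_zero_iff_norm.1 he, ?_⟩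
    have := (integral_eq_zero_iff_of_nonneg (fun y => abs_nonneg _) (hi e)).1 h0.symm
    refine prob_compl_eq_zero_iff (by measurability) |>.1 ?_
    refine measure_mono_null (fun y hy => ?_) this
    simpa [real_inner_comm] using hy
  · rcases eq_or_ne v 0 with rfl | hv
    · simp
    · have hv' := norm_pos_iff.2 hv
      have : ‖v‖⁻¹ • v ∈ Metric.sphere (0 : Ed d) 1 := by
        simp [norm_smul, hv'.ne']
      have := hmin this
      simp only [Set.mem_ofPred_eq, inner_smul_left, abs_mul, integral_const_mul] at this
      rw [← le_div_iff₀ hv']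
      refine this.trans (le_of_eq ?_)
      simp
      ring

/-- Coercivity of the maximal correlation on centered measures. -/
lemma exists_pos_forall_mul_integral_norm_le_maxCorr (hd : 1 ≤ d) [IsProbabilityMeasure μ]
    (hμ : FirstMoment μ) (hμc : Centered μ)
    (hμH : ¬ ∃ e : Ed d, ∃ ℓ : ℝ, ‖e‖ = 1 ∧ μ {y | (⟪y, e⟫ : ℝ) = ℓ} = 1) :
    ∃ c : ℝ, 0 < c ∧ ∀ ρ : Measure (Ed d), IsProbabilityMeasure ρ → FirstMoment ρ → Centered ρ →
      ((c * ∫ x, ‖x‖ ∂ρ : ℝ) : EReal) ≤ maxCorr ρ μ := by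
  obtain ⟨c, hc, hcv⟩ := exists_pos_forall_le_integral_abs_inner hd hμ hμH
  have hd' : (0 : ℝ) < d := by exact_mod_cast hd
  refine ⟨c / 4 / d, by positivity, fun ρ _ hρ hρc => ?_⟩
  have hxi : ∀ i, Integrable (fun x : Ed d => |x i|) ρ := fun i =>
    hρ.mono' (by fun_prop) (ae_of_all _ fun x => by
      simpa using PiLp.norm_apply_le x i)
  obtain ⟨i, -, hi⟩ : ∃ i ∈ (Finset.univ : Finset (Fin d)),
      (∫ x, ‖x‖ ∂ρ) / d ≤ ∫ x, |x i| ∂ρ := by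
    refine Finset.exists_le_of_sum_le ⟨⟨0, hd⟩, Finset.mem_univ _⟩ ?_
    rw [Finset.sum_const, Finset.card_univ, Fintype.card_fin, nsmul_eq_mul,
      mul_div_cancel₀ _ hd'.ne', ← integral_finsetSum _ fun i _ => hxi i]
    refine integral_mono hρ (integrable_finsetSum _ fun i _ => hxi i) fun x => ?_
    have hsum := (EuclideanSpace.basisFun (Fin d) ℝ).sum_repr x
    calc ‖x‖ = ‖∑ i, (EuclideanSpace.basisFun (Fin d) ℝ).repr x i •
          EuclideanSpace.basisFun (Fin d) ℝ i‖ := by rw [hsum]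
      _ ≤ ∑ i, |x i| := (norm_sum_le _ _).trans (le_of_eq (by simp [norm_smul]))
  have hm : Measurable fun x : Ed d => signum (x i) := measurable_signum.comp (by fun_prop)
  refine le_trans ?_ (integral_abs_inner_le_maxCorr hρ hρc hμ hμc hm fun x => (abs_signum _).le)
  set v := ∫ x, signum (x i) • x ∂ρ with hv
  have hvi : v i = ∫ x, |x i| ∂ρ := by
    have := (EuclideanSpace.proj i : Ed d →L[ℝ] ℝ).integral_comp_comm
      (hρ.integrable_smul hm fun x => (abs_signum _).le)
    simp only [PiLp.proj_apply, PiLp.smul_apply, smul_eq_mul, signum_mul_self] at this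
    exact this.symm
  have h1 : ∫ x, |x i| ∂ρ ≤ ‖v‖ := hvi ▸ (le_abs_self _).trans (PiLp.norm_apply_le v i)
  have h2 : c * ((∫ x, ‖x‖ ∂ρ) / d) ≤ c * ‖v‖ := by gcongr; exact hi.trans h1
  have h3 : c / 4 / d * ∫ x, ‖x‖ ∂ρ = 1 / 4 * (c * ((∫ x, ‖x‖ ∂ρ) / d)) := by ring
  rw [h3]
  exact_mod_cast mul_le_mul_of_nonneg_left (h2.trans (hcv v)) (by norm_num)

lemma maxCorr_map_add_le [IsProbabilityMeasure μ] (hμ : FirstMoment μ) (hμc : Centered μ)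
    (b : Ed d) : maxCorr (ρ.map (· + b)) μ ≤ maxCorr ρ μ := by
  refine iSup₂_le fun γ ⟨hγ, hfst, hsnd⟩ => ?_
  have hT : Measurable fun p : Ed d × Ed d => (p.1 + -b, p.2) := by fun_prop
  have hmem : γ.map (fun p => (p.1 + -b, p.2)) ∈ Couplings ρ μ := by
    refine ⟨Measure.isProbabilityMeasure_map hT.aemeasurable, ?_, ?_⟩
    · rw [Measure.fst, Measure.map_map measurable_fst hT]
      change γ.map ((· + -b) ∘ Prod.fst) = ρ
      rw [← Measure.map_map (by fun_prop) measurable_fst, ← Measure.fst, hfst,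
        Measure.map_map (by fun_prop) (by fun_prop)]
      convert Measure.map_id
      ext x
      simp
    · rw [Measure.snd, Measure.map_map measurable_snd hT]
      exact hsnd
  refine le_trans (le_of_eq ?_) (le_iSup₂ (f := fun γ _ => pairInt γ) _ hmem)
  change extIntegral γ _ = extIntegral _ _
  have hy : Integrable (fun p : Ed d × Ed d => p.2) γ := by
    have := hμ.integrable_id
    rw [← hsnd, Measure.snd] at this
    exact this.comp_measurable measurable_snd
  have h0 : ∫ p, p.2 ∂γ = 0 := by
    have : ∫ y, y ∂μ = 0 := hμc
    rw [← hsnd, Measure.snd, integral_map measurable_snd.aemeasurable (by fun_prop)] at this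
    exact this
  rw [extIntegral_map hT (by fun_prop)]
  simp only [inner_add_left]
  rw [extIntegral_add_integrable (by fun_prop) (hy.const_inner (-b)), integral_inner hy, h0]
  simp

section WeakLimit

variable {κ : Type*} {l : Filter κ} {ρs : κ → Measure (Ed d)}

lemma tendsto_integral_of_abs_le (hlim : ∀ f : BoundedContinuousFunction (Ed d) ℝ,
      Tendsto (fun n => ∫ x, f x ∂(ρs n)) l (𝓝 (∫ x, f x ∂ρ)))
    {f : Ed d → ℝ} (hf : Continuous f) {C : ℝ} (hC : ∀ x, |f x| ≤ C) :
    Tendsto (fun n => ∫ x, f x ∂(ρs n)) l (𝓝 (∫ x, f x ∂ρ)) :=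
  hlim (BoundedContinuousFunction.ofNormedAddCommGroup f hf C hC)

lemma tendsto_inner_integral_smul (hρ : FirstMoment ρ) (hρs : ∀ n, FirstMoment (ρs n))
    (hlim : ∀ f : BoundedContinuousFunction (Ed d) ℝ,
      Tendsto (fun n => ∫ x, f x ∂(ρs n)) l (𝓝 (∫ x, f x ∂ρ)))
    {φ : Ed d → ℝ} (hφ : Continuous φ) (hφ1 : ∀ x, |φ x| ≤ 1) {δ : ℝ}
    (hδ : ∀ x x', φ x ≠ 0 → φ x' ≠ 0 → ‖x - x'‖ ≤ δ) (Y : Ed d) :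
    Tendsto (fun n => (⟪∫ x, φ x • x ∂(ρs n), Y⟫ : ℝ)) l (𝓝 ⟪∫ x, φ x • x ∂ρ, Y⟫) := by
  have hrw : ∀ m : Measure (Ed d), FirstMoment m →
      (⟪∫ x, φ x • x ∂m, Y⟫ : ℝ) = ∫ x, φ x * ⟪Y, x⟫ ∂m := fun m hm => by
    rw [real_inner_comm, ← integral_inner (hm.integrable_smul hφ.measurable hφ1)]
    simp_rw [inner_smul_right]
  rw [hrw ρ hρ]
  simp_rw [hrw _ (hρs _)]
  by_cases h : ∃ x₀, φ x₀ ≠ 0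
  · obtain ⟨x₀, hx₀⟩ := h
    refine tendsto_integral_of_abs_le hlim (by fun_prop) (C := ‖Y‖ * (‖x₀‖ + δ)) fun x => ?_
    have hδ0 : 0 ≤ δ := (norm_nonneg _).trans (hδ x₀ x₀ hx₀ hx₀)
    by_cases hx : φ x = 0
    · rw [hx, zero_mul, abs_zero]
      positivity
    · have h1 : ‖x‖ ≤ ‖x₀‖ + δ := by
        have := norm_le_norm_add_norm_sub x₀ x
        have := hδ x x₀ hx hx₀
        rw [norm_sub_rev] at this
        linarith
      calc |φ x * ⟪Y, x⟫| = |φ x| * |(⟪Y, x⟫ : ℝ)| := abs_mul _ _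
        _ ≤ 1 * (‖Y‖ * ‖x‖) := by
          gcongr
          · exact hφ1 x
          · exact abs_real_inner_le_norm Y x
        _ ≤ ‖Y‖ * (‖x₀‖ + δ) := by rw [one_mul]; gcongr
  · push Not at h
    simpa [h] using tendsto_const_nhds

/-- The barycenter of a set of diameter at most `δ` is within `δ` of each of its points. -/
lemma norm_sub_inv_smul_integral_le [IsProbabilityMeasure ρ] (hρ : FirstMoment ρ) {φ : Ed d → ℝ}
    (hφ : Measurable φ) (h0 : ∀ x, 0 ≤ φ x) (hφ1 : ∀ x, |φ x| ≤ 1) {δ : ℝ}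
    (hδ : ∀ x x', φ x ≠ 0 → φ x' ≠ 0 → ‖x - x'‖ ≤ δ) (hpos : 0 < ∫ x, φ x ∂ρ)
    {x : Ed d} (hx : φ x ≠ 0) : ‖x - (∫ x, φ x ∂ρ)⁻¹ • ∫ x, φ x • x ∂ρ‖ ≤ δ := by
  have hi : Integrable φ ρ := Integrable.of_bound hφ.aestronglyMeasurable 1 (ae_of_all _ hφ1)
  have h1 : x - (∫ x, φ x ∂ρ)⁻¹ • ∫ x, φ x • x ∂ρ
      = (∫ x, φ x ∂ρ)⁻¹ • ∫ x', φ x' • (x - x') ∂ρ := by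
    simp_rw [smul_sub]
    rw [integral_sub (hi.smul_const x) (hρ.integrable_smul hφ hφ1), integral_smul_const,
      smul_sub, smul_smul, inv_mul_cancel₀ hpos.ne', one_smul]
  rw [h1, norm_smul, norm_inv, Real.norm_of_nonneg hpos.le, inv_mul_le_iff₀ hpos,
    ← integral_mul_const]
  refine norm_integral_le_of_norm_le (hi.mul_const δ) (ae_of_all _ fun x' => ?_)
  rw [norm_smul, Real.norm_of_nonneg (h0 x')]
  by_cases hx' : φ x' = 0
  · simp [hx']
  · exact mul_le_mul_of_nonneg_left (hδ x x' hx hx') (h0 x')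

lemma integrable_snd_of_coupling (hμ : FirstMoment μ) {γ : Measure (Ed d × Ed d)}
    (hγ : γ ∈ Couplings ρ μ) : Integrable (fun p : Ed d × Ed d => p.2) γ := by
  have := hμ.integrable_id
  rw [← hγ.2.2, Measure.snd] at this
  exact this.comp_measurable measurable_snd

lemma integral_fst_of_coupling {γ : Measure (Ed d × Ed d)} (hγ : γ ∈ Couplings ρ μ)
    {E : Type*} [NormedAddCommGroup E] [NormedSpace ℝ E] {f : Ed d → E}
    (hf : StronglyMeasurable f) : ∫ p, f p.1 ∂γ = ∫ x, f x ∂ρ := by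
  rw [← hγ.2.1, Measure.fst, integral_map measurable_fst.aemeasurable hf.aestronglyMeasurable]

/-- Replacing the first variable by its barycenter on a set of diameter at most `δ`. -/
lemma integral_mul_le_inv_mul_inner [IsProbabilityMeasure ρ]
    (hρ : FirstMoment ρ) (hμ : FirstMoment μ) {γ : Measure (Ed d × Ed d)}
    (hγ : γ ∈ Couplings ρ μ) {G : Ed d × Ed d → ℝ} (hG : Integrable G γ)
    (hGle : ∀ p, G p ≤ ⟪p.1, p.2⟫) {φ : Ed d → ℝ}
    (hφ : Measurable φ) (h0 : ∀ x, 0 ≤ φ x) (hφ1 : ∀ x, |φ x| ≤ 1) {δ : ℝ}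
    (hδ : ∀ x x', φ x ≠ 0 → φ x' ≠ 0 → ‖x - x'‖ ≤ δ) :
    ∫ p, φ p.1 * (G p - δ * ‖p.2‖) ∂γ
      ≤ (∫ x, φ x ∂ρ)⁻¹ * ⟪∫ x, φ x • x ∂ρ, ∫ p, φ p.1 • p.2 ∂γ⟫ := by
  have := hγ.1
  have hy := integrable_snd_of_coupling hμ hγ
  have hφγ : AEStronglyMeasurable (fun p : Ed d × Ed d => φ p.1) γ :=
    (hφ.comp measurable_fst).aestronglyMeasurable
  have hφ1' : ∀ p : Ed d × Ed d, ‖φ p.1‖ ≤ 1 := fun p => hφ1 p.1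
  have hiφ : Integrable (fun p : Ed d × Ed d => φ p.1) γ :=
    Integrable.of_bound hφγ 1 (ae_of_all _ hφ1')
  have hiG : Integrable (fun p => φ p.1 * (G p - δ * ‖p.2‖)) γ :=
    (hG.sub (hy.norm.const_mul δ)).bdd_mul hφγ (ae_of_all _ hφ1')
  have hφy : Integrable (fun p : Ed d × Ed d => φ p.1 • p.2) γ :=
    hy.bdd_smul 1 hφγ (ae_of_all _ hφ1')
  have hm := integral_fst_of_coupling hγ hφ.stronglyMeasurable
  rcases (integral_nonneg h0 : 0 ≤ ∫ x, φ x ∂ρ).eq_or_lt with hz | hpos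
  · have hae : (fun p : Ed d × Ed d => φ p.1) =ᵐ[γ] 0 :=
      (integral_eq_zero_iff_of_nonneg (fun p : Ed d × Ed d => h0 p.1) hiφ).1 (hm.trans hz.symm)
    rw [← hz, inv_zero, zero_mul]
    refine (integral_eq_zero_of_ae (hae.mono fun p hp => ?_)).le
    simp only [Pi.zero_apply] at hp ⊢
    rw [hp, zero_mul]
  · rw [← real_inner_smul_left, ← integral_inner hφy]
    refine integral_mono hiG (hφy.const_inner _) fun p => ?_
    simp only [inner_smul_right]
    by_cases hp : φ p.1 = 0
    · simp [hp]
    · refine mul_le_mul_of_nonneg_left ?_ (h0 p.1)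
      have h1 := norm_sub_inv_smul_integral_le hρ hφ h0 hφ1 hδ hpos hp
      have h2 := real_inner_le_norm (p.1 - (∫ x, φ x ∂ρ)⁻¹ • ∫ x, φ x • x ∂ρ) p.2
      rw [inner_sub_left] at h2
      have h3 := mul_le_mul_of_nonneg_right h1 (norm_nonneg p.2)
      linarith [hGle p]

/-- Given a coupling `γ` of `ρ` and `μ`, a density `φ` on the first factor and a complementary
density `ψ`, the measure obtained by mixing the second marginals of `φ • γ` and `ψ • γ`. -/
def mixedMarginal (γ : Measure (Ed d × Ed d)) (a b : ℝ) (φ ψ : Ed d → ℝ) : Measure (Ed d) :=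
  ENNReal.ofReal a • (realDensity γ fun p => φ p.1).snd +
    ENNReal.ofReal b • (realDensity γ fun p => ψ p.1).snd

section MixedMarginal

variable {γ : Measure (Ed d × Ed d)} {a b : ℝ} {φ ψ : Ed d → ℝ}

lemma mixedMarginal_univ (hγ : γ ∈ Couplings ρ μ) (ha : 0 ≤ a) (hb : 0 ≤ b)
    (hφ : Measurable φ) (hψ : Measurable ψ) (hφ0 : ∀ x, 0 ≤ φ x) (hψ0 : ∀ x, 0 ≤ ψ x)
    (hφ1 : ∀ x, φ x ≤ 1) (hψ1 : ∀ x, ψ x ≤ 1) :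
    mixedMarginal γ a b φ ψ Set.univ
      = ENNReal.ofReal (a * ∫ x, φ x ∂ρ + b * ∫ x, ψ x ∂ρ) := by
  have := hγ.1
  have hi : ∀ {f : Ed d → ℝ}, Measurable f → (∀ x, 0 ≤ f x) → (∀ x, f x ≤ 1) →
      Integrable (fun p : Ed d × Ed d => f p.1) γ := fun hf hf0 hf1 =>
    Integrable.of_bound (hf.comp measurable_fst).aestronglyMeasurable 1
      (ae_of_all _ fun p => by rw [Real.norm_of_nonneg (hf0 _)]; exact hf1 _)
  simp only [mixedMarginal, Measure.add_apply, Measure.smul_apply, Measure.snd_univ, smul_eq_mul]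
  rw [realDensity_univ (hi hφ hφ0 hφ1) fun p => hφ0 p.1,
    realDensity_univ (hi hψ hψ0 hψ1) fun p => hψ0 p.1,
    integral_fst_of_coupling hγ hφ.stronglyMeasurable,
    integral_fst_of_coupling hγ hψ.stronglyMeasurable,
    ← ENNReal.ofReal_mul ha, ← ENNReal.ofReal_mul hb, ← ENNReal.ofReal_add]
  · exact mul_nonneg ha (integral_nonneg hφ0)
  · exact mul_nonneg hb (integral_nonneg hψ0)

lemma integrable_snd_realDensity (hμ : FirstMoment μ) (hγ : γ ∈ Couplings ρ μ)
    (hφ : Measurable φ) (hφ0 : ∀ x, 0 ≤ φ x) (hφ1 : ∀ x, φ x ≤ 1) :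
    Integrable (fun y => y) (realDensity γ fun p => φ p.1).snd := by
  rw [Measure.snd, integrable_map_measure (by fun_prop) measurable_snd.aemeasurable]
  exact integrable_realDensity (integrable_snd_of_coupling hμ hγ) (hφ.comp measurable_fst)
    (fun p => hφ0 p.1) fun p => hφ1 p.1

lemma integrable_mixedMarginal (hμ : FirstMoment μ) (hγ : γ ∈ Couplings ρ μ)
    (hφ : Measurable φ) (hψ : Measurable ψ) (hφ0 : ∀ x, 0 ≤ φ x) (hψ0 : ∀ x, 0 ≤ ψ x)
    (hφ1 : ∀ x, φ x ≤ 1) (hψ1 : ∀ x, ψ x ≤ 1) :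
    Integrable (fun y => y) (mixedMarginal γ a b φ ψ) :=
  ((integrable_snd_realDensity hμ hγ hφ hφ0 hφ1).smul_measure ENNReal.ofReal_ne_top).add_measure
    ((integrable_snd_realDensity hμ hγ hψ hψ0 hψ1).smul_measure ENNReal.ofReal_ne_top)

lemma integral_mixedMarginal (hμ : FirstMoment μ) (hγ : γ ∈ Couplings ρ μ) (ha : 0 ≤ a)
    (hb : 0 ≤ b) (hφ : Measurable φ) (hψ : Measurable ψ) (hφ0 : ∀ x, 0 ≤ φ x)
    (hψ0 : ∀ x, 0 ≤ ψ x) (hφ1 : ∀ x, φ x ≤ 1) (hψ1 : ∀ x, ψ x ≤ 1) :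
    ∫ y, y ∂(mixedMarginal γ a b φ ψ)
      = a • (∫ p, φ p.1 • p.2 ∂γ) + b • ∫ p, ψ p.1 • p.2 ∂γ := by
  rw [mixedMarginal, integral_add_measure
    ((integrable_snd_realDensity hμ hγ hφ hφ0 hφ1).smul_measure ENNReal.ofReal_ne_top)
    ((integrable_snd_realDensity hμ hγ hψ hψ0 hψ1).smul_measure ENNReal.ofReal_ne_top),
    integral_smul_measure, integral_smul_measure, ENNReal.toReal_ofReal ha,
    ENNReal.toReal_ofReal hb, Measure.snd, Measure.snd,
    integral_map measurable_snd.aemeasurable (by fun_prop),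
    integral_map measurable_snd.aemeasurable (by fun_prop),
    integral_realDensity (g := fun p : Ed d × Ed d => φ p.1) (hφ.comp measurable_fst)
      fun p => hφ0 p.1,
    integral_realDensity (g := fun p : Ed d × Ed d => ψ p.1) (hψ.comp measurable_fst)
      fun p => hψ0 p.1]

lemma sum_mixedMarginal (hγ : γ ∈ Couplings ρ μ) {ι : Type*} [Fintype ι] {φ : ι → Ed d → ℝ}
    (hφ : ∀ i, Measurable (φ i)) (h0 : ∀ i x, 0 ≤ φ i x) (hψ0 : ∀ x, 0 ≤ ψ x)
    (hsum : ∀ x, ∑ i, φ i x + ψ x = 1) {m : ι → ℝ} (hm : ∀ i, 0 ≤ m i) (ha : ∑ i, m i = a) :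
    ∑ i, mixedMarginal γ a (m i) (φ i) ψ = ENNReal.ofReal a • μ := by
  simp only [mixedMarginal]
  rw [Finset.sum_add_distrib, ← Finset.smul_sum, ← Finset.sum_smul,
    ← ENNReal.ofReal_sum_of_nonneg fun i _ => hm i, ha, ← smul_add]
  congr 1
  simp only [Measure.snd]
  rw [← Measure.map_finset_sum' measurable_snd.aemeasurable,
    ← Measure.map_add _ _ measurable_snd,
    ← realDensity_sum (g := fun i (p : Ed d × Ed d) => φ i p.1) _
      (fun i => (hφ i).comp measurable_fst) fun i p => h0 i p.1,
    ← realDensity_add (g := fun p : Ed d × Ed d => ∑ i, φ i p.1) (h := fun p : Ed d × Ed d => ψ p.1)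
      (Finset.measurable_sum _ fun i _ => (hφ i).comp measurable_fst)
      (fun p => Finset.sum_nonneg fun i _ => h0 i p.1) fun p => hψ0 p.1]
  simp only [hsum, realDensity_one]
  exact hγ.2.2

end MixedMarginal

/-- A lower bound for the maximal correlation along a weakly converging family, in terms of a
continuous subpartition of unity subordinate to sets of diameter at most `δ`. -/
lemma eventually_le_maxCorr_of_partition [∀ n, IsProbabilityMeasure (ρs n)]
    [IsProbabilityMeasure ρ] [IsProbabilityMeasure μ] (hρ : FirstMoment ρ)
    (hρs : ∀ n, FirstMoment (ρs n)) (hμ : FirstMoment μ) (hμc : Centered μ)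
    (hlim : ∀ f : BoundedContinuousFunction (Ed d) ℝ,
      Tendsto (fun n => ∫ x, f x ∂(ρs n)) l (𝓝 (∫ x, f x ∂ρ)))
    {γ : Measure (Ed d × Ed d)} (hγ : γ ∈ Couplings ρ μ) {G : Ed d × Ed d → ℝ}
    (hG : Integrable G γ) (hGle : ∀ p, G p ≤ ⟪p.1, p.2⟫) {ι : Type*} [Fintype ι]
    {φ : ι → Ed d → ℝ} (hφ : ∀ i, Continuous (φ i)) (h0 : ∀ i x, 0 ≤ φ i x)
    {χ : Ed d → ℝ} (hχ : ∀ x, ∑ i, φ i x = χ x) (hχ1 : ∀ x, χ x ≤ 1) {δ : ℝ}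
    (hδ : ∀ i x x', φ i x ≠ 0 → φ i x' ≠ 0 → ‖x - x'‖ ≤ δ) {t : ℝ}
    (ht : t < (∫ x, χ x ∂ρ) * (∫ p, χ p.1 * (G p - δ * ‖p.2‖) ∂γ)
      + ⟪∫ x, χ x • x ∂ρ, ∫ p, (1 - χ p.1) • p.2 ∂γ⟫) :
    ∀ᶠ n in l, (t : EReal) ≤ maxCorr (ρs n) μ := by
  have := hγ.1
  have hφm : ∀ i, Measurable (φ i) := fun i => (hφ i).measurable
  have hφχ : ∀ i x, φ i x ≤ χ x := fun i x =>
    hχ x ▸ Finset.single_le_sum (fun j _ => h0 j x) (Finset.mem_univ i)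
  have hφ1 : ∀ i x, φ i x ≤ 1 := fun i x => (hφχ i x).trans (hχ1 x)
  have hφa : ∀ i x, |φ i x| ≤ 1 := fun i x => by rw [abs_of_nonneg (h0 i x)]; exact hφ1 i x
  have hχ0 : ∀ x, 0 ≤ χ x := fun x => hχ x ▸ Finset.sum_nonneg fun i _ => h0 i x
  have hχm : Measurable χ := by
    simp_rw [funext fun x => (hχ x).symm]
    fun_prop
  have hi : ∀ i, Integrable (φ i) ρ := fun i =>
    Integrable.of_bound (hφm i).aestronglyMeasurable 1 (ae_of_all _ (hφa i))
  set m : ι → ℝ := fun i => ∫ x, φ i x ∂ρ with hm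
  have hm0 : ∀ i, 0 ≤ m i := fun i => integral_nonneg (h0 i)
  set a : ℝ := ∫ x, χ x ∂ρ with ha
  have hma : ∑ i, m i = a := by
    rw [ha, hm, ← integral_finsetSum _ fun i _ => hi i]
    simp_rw [hχ]
  have ha0 : 0 ≤ a := integral_nonneg hχ0
  have hψm : Measurable fun x => 1 - χ x := by fun_prop
  have hψ0 : ∀ x, 0 ≤ 1 - χ x := fun x => sub_nonneg.2 (hχ1 x)
  have hψ1 : ∀ x, 1 - χ x ≤ 1 := fun x => sub_le_self _ (hχ0 x)
  have hψi : ∫ x, (1 - χ x) ∂ρ = 1 - a := by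
    rw [integral_sub (integrable_const _) (Integrable.of_bound hχm.aestronglyMeasurable 1
      (ae_of_all _ fun x => by rw [Real.norm_of_nonneg (hχ0 x)]; exact hχ1 x))]
    simp [ha]
  set B : ι → Ed d := fun i => ∫ x, φ i x • x ∂ρ with hB
  set D : ι → Ed d := fun i => ∫ p, φ i p.1 • p.2 ∂γ with hD
  set D₀ : Ed d := ∫ p, (1 - χ p.1) • p.2 ∂γ with hD₀
  set ν : ι → Measure (Ed d) := fun i => mixedMarginal γ a (m i) (φ i) fun x => 1 - χ x with hν
  set Y : ι → Ed d := fun i => ∫ y, y ∂(ν i) with hY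
  have hYe : ∀ i, Y i = a • D i + m i • D₀ := fun i =>
    integral_mixedMarginal hμ hγ ha0 (hm0 i) (hφm i) hψm (h0 i) hψ0 (hφ1 i) hψ1
  have hνu : ∀ i, ν i Set.univ = ENNReal.ofReal (m i) := fun i => by
    rw [hν, mixedMarginal_univ hγ ha0 (hm0 i) (hφm i) hψm (h0 i) hψ0 (hφ1 i) hψ1, hψi]
    congr 1
    simp only [hm]
    ring
  have hνz : ∀ i, m i = 0 → ν i = 0 := fun i h => by
    rw [← Measure.measure_univ_eq_zero, hνu, h, ENNReal.ofReal_zero]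
  have hνf : ∀ i, IsFiniteMeasure (ν i) := fun i => ⟨by rw [hνu]; exact ENNReal.ofReal_lt_top⟩
  have hνs : ∑ i, ν i = ENNReal.ofReal a • μ :=
    sum_mixedMarginal hγ hφm h0 hψ0 (fun x => by rw [hχ]; ring) hm0 hma
  have hV : t < ∑ i, (m i)⁻¹ * ⟪B i, Y i⟫ := by
    refine ht.trans_le ?_
    have e1 : ∫ x, χ x • x ∂ρ = ∑ i, B i := by
      simp only [hB]
      rw [← integral_finsetSum _ fun i _ => hρ.integrable_smul (hφm i) (hφa i)]
      simp_rw [← Finset.sum_smul, hχ]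
    have hint : ∀ i, Integrable (fun p => φ i p.1 * (G p - δ * ‖p.2‖)) γ := fun i =>
      (hG.sub ((integrable_snd_of_coupling hμ hγ).norm.const_mul δ)).bdd_mul
        ((hφm i).comp measurable_fst).aestronglyMeasurable (ae_of_all _ fun p => hφa i p.1)
    have e2 : ∫ p, χ p.1 * (G p - δ * ‖p.2‖) ∂γ
        = ∑ i, ∫ p, φ i p.1 * (G p - δ * ‖p.2‖) ∂γ := by
      rw [← integral_finsetSum _ fun i _ => hint i]
      simp_rw [← Finset.sum_mul, hχ]
    rw [e1, e2, Finset.mul_sum, sum_inner, ← Finset.sum_add_distrib]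
    refine Finset.sum_le_sum fun i _ => ?_
    have h1 := integral_mul_le_inv_mul_inner hρ hμ hγ hG hGle (hφm i) (h0 i) (hφa i) (hδ i)
    have h2 := mul_le_mul_of_nonneg_left h1 ha0
    rw [hYe, inner_add_right, inner_smul_right, inner_smul_right, mul_add]
    have h3 : (m i)⁻¹ * (m i * ⟪B i, D₀⟫) = ⟪B i, D₀⟫ := by
      rcases eq_or_ne (m i) 0 with h | h
      · have hz := (integral_eq_zero_iff_of_nonneg (h0 i) (hi i)).1 h
        have : B i = 0 := integral_eq_zero_of_ae (hz.mono fun x hx => by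
          simp only [Pi.zero_apply] at hx ⊢
          rw [hx, zero_smul])
        simp [this]
      · rw [inv_mul_cancel_left₀ h]
    rw [h3]
    linarith
  obtain ⟨θ, ⟨hθ0, hθ1⟩, hθt⟩ : ∃ θ ∈ Set.Ioo (0 : ℝ) 1,
      t < ∑ i, θ * (m i)⁻¹ * ⟪B i, Y i⟫ := by
    have hc : Tendsto (fun θ : ℝ => ∑ i, θ * (m i)⁻¹ * ⟪B i, Y i⟫) (𝓝[<] 1)
        (𝓝 (∑ i, 1 * (m i)⁻¹ * ⟪B i, Y i⟫)) := by
      refine Tendsto.mono_left (Continuous.tendsto ?_ 1) nhdsWithin_le_nhds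
      fun_prop
    simp only [one_mul] at hc
    obtain ⟨θ, h1, h2⟩ := ((hc.eventually_const_lt hV).and (Ioo_mem_nhdsLT zero_lt_one)).exists
    exact ⟨θ, h2, h1⟩
  have hmlim : ∀ i, Tendsto (fun n => ∫ x, φ i x ∂(ρs n)) l (𝓝 (m i)) := fun i =>
    tendsto_integral_of_abs_le hlim (hφ i) (hφa i)
  have hBlim : ∀ i, Tendsto (fun n => (⟪∫ x, φ i x • x ∂(ρs n), Y i⟫ : ℝ)) l (𝓝 ⟪B i, Y i⟫) :=
    fun i => tendsto_inner_integral_smul hρ hρs hlim (hφ i) (hφa i) (hδ i) (Y i)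
  have hsum : Tendsto (fun n => ∑ i, θ * (∫ x, φ i x ∂(ρs n))⁻¹ *
      ⟪∫ x, φ i x • x ∂(ρs n), Y i⟫) l (𝓝 (∑ i, θ * (m i)⁻¹ * ⟪B i, Y i⟫)) := by
    refine tendsto_finsetSum _ fun i _ => ?_
    rcases eq_or_ne (m i) 0 with h | h
    · have : Y i = 0 := by simp [hY, hνz i h]
      simpa [this] using tendsto_const_nhds
    · exact (((hmlim i).inv₀ h).const_mul θ).mul (hBlim i)
  have hle : ∀ᶠ n in l, ∀ i, θ * m i ≤ ∫ x, φ i x ∂(ρs n) := by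
    refine eventually_all.2 fun i => ?_
    rcases (hm0 i).eq_or_lt with h | h
    · exact Eventually.of_forall fun n => by
        rw [← h, mul_zero]
        exact integral_nonneg (h0 i)
    · exact ((hmlim i).eventually_const_lt (mul_lt_of_lt_one_left h hθ1)).mono fun n => le_of_lt
  filter_upwards [hle, hsum.eventually_const_lt hθt] with n hn hnt
  refine (EReal.coe_le_coe_iff.2 hnt.le).trans ?_
  have hs0 : ∀ i, 0 ≤ θ * (∫ x, φ i x ∂(ρs n))⁻¹ := fun i =>
    mul_nonneg hθ0.le (inv_nonneg.2 (integral_nonneg (h0 i)))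
  have key := sum_inner_le_maxCorr (hρs n) hμ hμc
    (g := fun i x => θ * (∫ x, φ i x ∂(ρs n))⁻¹ * φ i x) (fun i => (hφm i).const_mul _)
    (fun i x => mul_nonneg (hs0 i) (h0 i x)) (C := fun i => θ * (∫ x, φ i x ∂(ρs n))⁻¹)
    (fun i x => mul_le_of_le_one_right (hs0 i) (hφ1 i x)) (ν := ν)
    (fun i => integrable_mixedMarginal hμ hγ (hφm i) hψm (h0 i) hψ0 (hφ1 i) hψ1)
    (fun x => (Finset.sum_le_sum fun i _ => ?_).trans ((hχ x).trans_le (hχ1 x)))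
    (θ := θ * a) (by positivity) ?_
  · refine le_trans (le_of_eq ?_) key
    simp_rw [mul_smul, integral_smul, real_inner_smul_left]
    simp only [hY, mul_assoc]
  · rw [measureReal_def, hνu, ENNReal.toReal_ofReal (hm0 i), ← mul_assoc]
    refine mul_le_of_le_one_left (h0 i x) ?_
    rw [← mul_assoc, mul_comm (m i), ← div_eq_mul_inv]
    exact div_le_one_of_le₀ (hn i) (integral_nonneg (h0 i))
  · rw [ENNReal.ofReal_mul hθ0.le, mul_smul, ← hνs, Finset.smul_sum]
    refine Finset.sum_congr rfl fun i _ => ?_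
    rcases eq_or_ne (m i) 0 with h | h
    · simp [hνz i h]
    · have : ∫ x, φ i x ∂(ρs n) ≠ 0 :=
        ((mul_pos hθ0 ((hm0 i).lt_of_ne' h)).trans_le (hn i)).ne'
      rw [integral_const_mul, mul_assoc, inv_mul_cancel₀ this, mul_one]

/-- Finite continuous subpartitions of unity subordinate to small sets, exhausting the space. -/
lemma exists_subpartition {X : Type*} [PseudoMetricSpace X] [TopologicalSpace.SeparableSpace X]
    [Nonempty X]
    {δ : ℝ} (hδ : 0 < δ) :
    ∃ (φ : ∀ k : ℕ, Fin k → X → ℝ) (χ : ℕ → X → ℝ), (∀ k i, Continuous (φ k i)) ∧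
      (∀ k i x, 0 ≤ φ k i x) ∧ (∀ k x, ∑ i, φ k i x = χ k x) ∧ (∀ k x, χ k x ≤ 1) ∧
      (∀ k i x x', φ k i x ≠ 0 → φ k i x' ≠ 0 → dist x x' ≤ δ) ∧
      ∀ x, Tendsto (fun k => χ k x) atTop (𝓝 1) := by
  set u := TopologicalSpace.denseSeq X
  set ψ : ℕ → X → ℝ := fun j x => max 0 (δ / 2 - dist x (u j)) with hψ
  have hψ0 : ∀ j x, 0 ≤ ψ j x := fun j x => le_max_left _ _
  have hψc : ∀ j, Continuous (ψ j) := fun j => by fun_prop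
  set S : ℕ → X → ℝ := fun k x => ∑ i : Fin k, ψ i x with hS
  have hS0 : ∀ k x, 0 ≤ S k x := fun k x => Finset.sum_nonneg fun i _ => hψ0 i x
  have hε : ∀ k : ℕ, 0 < 1 / ((k : ℝ) + 1) := fun k => Nat.one_div_pos_of_nat
  have hw : ∀ k x, 0 < S k x + 1 / ((k : ℝ) + 1) := fun k x =>
    add_pos_of_nonneg_of_pos (hS0 k x) (hε k)
  refine ⟨fun k i x => ψ i x / (S k x + 1 / ((k : ℝ) + 1)),
    fun k x => S k x / (S k x + 1 / ((k : ℝ) + 1)), fun k i => ?_, fun k i x => ?_, fun k x => ?_,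
    fun k x => ?_, fun k i x x' hx hx' => ?_, fun x => ?_⟩
  · have : Continuous (S k) := continuous_finsetSum _ fun i _ => hψc i
    exact (hψc i).div (by fun_prop) fun x => (hw k x).ne'
  · exact div_nonneg (hψ0 i x) (hw k x).le
  · rw [← Finset.sum_div]
  · exact div_le_one_of_le₀ (le_add_of_nonneg_right (hε k).le) (hw k x).le
  · have hlt : ∀ z, ψ i z / (S k z + 1 / ((k : ℝ) + 1)) ≠ 0 → dist z (u i) < δ / 2 := by
      intro z hz
      by_contra! h
      exact hz (by simp [hψ, h])
    have h1 := hlt x hx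
    have h2 := hlt x' hx'
    rw [dist_comm] at h2
    linarith [dist_triangle x (u i) x']
  · obtain ⟨j, hj⟩ : ∃ j, dist x (u j) < δ / 2 := by
      obtain ⟨y, hy, j, rfl⟩ := Metric.dense_iff.1 (TopologicalSpace.denseRange_denseSeq X) x
        (δ / 2) (by linarith)
      exact ⟨j, by rwa [dist_comm]⟩
    have hs : 0 < ψ j x := lt_max_of_lt_right (by linarith)
    have hlim : Tendsto (fun k : ℕ => 1 - 1 / ((k : ℝ) + 1) / ψ j x) atTop (𝓝 1) := by
      simpa using (tendsto_one_div_add_atTop_nhds_zero_nat.div_const (ψ j x)).const_sub (1 : ℝ)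
    refine tendsto_of_tendsto_of_tendsto_of_le_of_le' hlim tendsto_const_nhds ?_
      (Eventually.of_forall fun k =>
        div_le_one_of_le₀ (le_add_of_nonneg_right (hε k).le) (hw k x).le)
    filter_upwards [eventually_gt_atTop j] with k hk
    have hle : ψ j x ≤ S k x :=
      Finset.single_le_sum (f := fun i : Fin k => ψ i x) (fun i _ => hψ0 i x)
        (Finset.mem_univ ⟨j, hk⟩)
    have h1 : S k x / (S k x + 1 / ((k : ℝ) + 1))
        = 1 - 1 / ((k : ℝ) + 1) / (S k x + 1 / ((k : ℝ) + 1)) := by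
      rw [eq_sub_iff_add_eq, ← add_div, div_self (hw k x).ne']
    rw [h1]
    exact sub_le_sub_left (div_le_div_of_nonneg_left (hε k).le hs
      (hle.trans (le_add_of_nonneg_right (hε k).le))) _

lemma tendsto_integral_smul_of_tendsto_one {α E : Type*} [MeasurableSpace α]
    [NormedAddCommGroup E] [NormedSpace ℝ E] {m : Measure α} {f : α → E} (hf : Integrable f m)
    {χ : ℕ → α → ℝ} (hχ : ∀ k, Measurable (χ k)) (hχ1 : ∀ k x, |χ k x| ≤ 1) {c : ℝ}
    (hlim : ∀ x, Tendsto (fun k => χ k x) atTop (𝓝 c)) :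
    Tendsto (fun k => ∫ x, χ k x • f x ∂m) atTop (𝓝 (c • ∫ x, f x ∂m)) := by
  rw [← integral_smul]
  refine tendsto_integral_of_dominated_convergence (fun x => ‖f x‖)
    (fun k => (hχ k).aestronglyMeasurable.smul hf.aestronglyMeasurable) hf.norm
    (fun k => ae_of_all _ fun x => ?_) (ae_of_all _ fun x => (hlim x).smul_const (f x))
  rw [norm_smul]
  exact mul_le_of_le_one_left (norm_nonneg _) (hχ1 k x)

/-- Lower semicontinuity of the maximal correlation in its first argument. -/
lemma eventually_le_maxCorr_of_tendsto [∀ n, IsProbabilityMeasure (ρs n)]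
    [IsProbabilityMeasure ρ] [IsProbabilityMeasure μ] (hρ : FirstMoment ρ)
    (hρs : ∀ n, FirstMoment (ρs n)) (hμ : FirstMoment μ) (hμc : Centered μ)
    (hlim : ∀ f : BoundedContinuousFunction (Ed d) ℝ,
      Tendsto (fun n => ∫ x, f x ∂(ρs n)) l (𝓝 (∫ x, f x ∂ρ)))
    {t : ℝ} (ht : (t : EReal) < maxCorr ρ μ) : ∀ᶠ n in l, (t : EReal) ≤ maxCorr (ρs n) μ := by
  simp only [maxCorr, lt_iSup_iff] at ht
  obtain ⟨γ, hγ, hγt⟩ := ht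
  have := hγ.1
  obtain ⟨G, hG, hGle, hGt⟩ := exists_integrable_le_of_lt_extIntegral (m := γ)
    (F := fun p : Ed d × Ed d => ⟪p.1, p.2⟫) (by fun_prop) hγt
  have hy := integrable_snd_of_coupling hμ hγ
  set M := ∫ p, ‖p.2‖ ∂γ with hM
  have hM0 : 0 ≤ M := integral_nonneg fun p => norm_nonneg _
  obtain ⟨δ, hδ, hδt⟩ : ∃ δ : ℝ, 0 < δ ∧ t < ∫ p, (G p - δ * ‖p.2‖) ∂γ := by
    refine ⟨(∫ p, G p ∂γ - t) / (M + 1), div_pos (sub_pos.2 hGt) (by linarith), ?_⟩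
    rw [integral_sub hG (hy.norm.const_mul _), integral_const_mul, ← hM]
    have h1 := sub_pos.2 hGt
    have h2 : (∫ p, G p ∂γ - t) / (M + 1) * M < ∫ p, G p ∂γ - t := by
      rw [div_mul_eq_mul_div, div_lt_iff₀ (by linarith)]
      nlinarith
    linarith
  obtain ⟨φ, χ, hφ, h0, hχ, hχ1, hφδ, hχlim⟩ := exists_subpartition (X := Ed d) hδ
  have hχ0 : ∀ k x, 0 ≤ χ k x := fun k x => hχ k x ▸ Finset.sum_nonneg fun i _ => h0 k i x
  have hχa : ∀ k x, |χ k x| ≤ 1 := fun k x => by rw [abs_of_nonneg (hχ0 k x)]; exact hχ1 k x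
  have hχm : ∀ k, Measurable (χ k) := fun k => by
    simp_rw [funext fun x => (hχ k x).symm]
    have := fun i => (hφ k i).measurable
    fun_prop
  have l1 := tendsto_integral_smul_of_tendsto_one (m := ρ) (integrable_const (1 : ℝ)) hχm hχa hχlim
  have l2 := tendsto_integral_smul_of_tendsto_one (hG.sub (hy.norm.const_mul δ))
    (χ := fun k p => χ k p.1) (fun k => (hχm k).comp measurable_fst) (fun k p => hχa k p.1)
    fun p => hχlim p.1
  have l3 := tendsto_integral_smul_of_tendsto_one hρ.integrable_id hχm hχa hχlim
  have l4 := tendsto_integral_smul_of_tendsto_one hy (χ := fun k p => 1 - χ k p.1)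
    (fun k => ((hχm k).comp measurable_fst).const_sub 1)
    (fun k p => by
      rw [abs_of_nonneg (sub_nonneg.2 (hχ1 k _))]
      exact sub_le_self _ (hχ0 k _))
    fun p => (hχlim p.1).const_sub 1
  have hR := (l1.mul l2).add (l3.inner l4 (𝕜 := ℝ))
  simp only [smul_eq_mul, mul_one, one_smul, sub_self, zero_smul, inner_zero_right, add_zero,
    integral_const, probReal_univ, one_mul, Pi.sub_apply] at hR
  obtain ⟨k, hk⟩ := (hR.eventually_const_lt hδt).exists
  exact eventually_le_maxCorr_of_partition hρ hρs hμ hμc hlim hγ hG hGle (hφ k) (h0 k) (hχ k)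
    (hχ1 k) (fun i x x' hx hx' => dist_eq_norm x x' ▸ hφδ k i x x' hx hx') hk

end WeakLimit

lemma maxCorr_le_of_norm_le_one (hμ : FirstMoment μ) (h1 : ∀ᵐ x ∂ρ, ‖x‖ ≤ 1) :
    maxCorr ρ μ ≤ ((∫ y, ‖y‖ ∂μ : ℝ) : EReal) := by
  refine iSup₂_le fun γ hγ => ?_
  have hfst : ∀ᵐ p ∂γ, ‖p.1‖ ≤ 1 := by
    rw [← hγ.2.1, Measure.fst] at h1
    exact ae_of_ae_map measurable_fst.aemeasurable h1
  have hsnd : Integrable (fun p : Ed d × Ed d => ‖p.2‖) γ :=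
    (integrable_snd_of_coupling hμ hγ).norm
  have hint : ∫ p, ‖p.2‖ ∂γ = ∫ y, ‖y‖ ∂μ := by
    rw [← hγ.2.2, Measure.snd,
      integral_map measurable_snd.aemeasurable continuous_norm.aestronglyMeasurable]
  change extIntegral γ (fun p => ⟪p.1, p.2⟫) ≤ _
  rw [← hint, ← extIntegral_of_integrable hsnd, extIntegral_congr_ae
    (G := fun p => min ⟪p.1, p.2⟫ ‖p.2‖) (hfst.mono fun p hp => ?_)]
  · exact extIntegral_mono fun p => min_le_right _ _
  · refine (min_eq_left ((real_inner_le_norm _ _).trans ?_)).symm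
    exact mul_le_of_le_one_left (norm_nonneg _) hp

/-- The uniform measure on the unit ball has finite entropy. -/
lemma exists_entropy_ne_top (d : ℕ) : ∃ ρ : Measure (Ed d), IsProbabilityMeasure ρ ∧
    (∀ᵐ x ∂ρ, ‖x‖ ≤ 1) ∧ entropy ρ ≠ ⊤ := by
  set B : Set (Ed d) := Metric.closedBall 0 1
  have hB : MeasurableSet B := Metric.isClosed_closedBall.measurableSet
  have hv0 : volume B ≠ 0 := (Metric.measure_closedBall_pos volume _ one_pos).ne'
  have hvt : volume B ≠ ⊤ := measure_closedBall_lt_top.ne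
  set f : Ed d → ℝ≥0∞ := B.indicator fun _ => (volume B)⁻¹
  have hf : Measurable f := measurable_const.indicator hB
  have hac : volume.withDensity f ≪ volume := withDensity_absolutelyContinuous _ _
  refine ⟨volume.withDensity f, ⟨?_⟩, ?_, ?_⟩
  · rw [withDensity_apply _ MeasurableSet.univ, Measure.restrict_univ, lintegral_indicator hB,
      setLIntegral_const, ENNReal.inv_mul_cancel hv0 hvt]
  · rw [withDensity_indicator hB, withDensity_const]
    refine Measure.ae_smul_measure ?_ _
    filter_upwards [ae_restrict_mem hB] with x hx
    simpa [B] using hx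
  · have hae : entropyIntegrand (volume.withDensity f) =ᵐ[volume]
        B.indicator fun _ => (volume B)⁻¹.toReal * Real.log (volume B)⁻¹.toReal := by
      filter_upwards [Measure.rnDeriv_withDensity volume hf] with x hx
      by_cases hxB : x ∈ B <;> simp [entropyIntegrand, hx, f, hxB]
    rw [entropy_of_ac hac, extIntegral_congr_ae hae, extIntegral_of_integrable]
    · exact EReal.coe_ne_top _
    · exact (integrable_indicator_iff hB).2 (integrableOn_const hvt)

lemma neg_mul_integral_norm_sub_le_entropy [IsProbabilityMeasure ρ] (hρ : FirstMoment ρ) {ε : ℝ}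
    (hε : 0 < ε) : ((-(ε * ∫ x, ‖x‖ ∂ρ) - ∫ x : Ed d, rexp (-(ε * ‖x‖) - 1) : ℝ) : EReal)
      ≤ entropy ρ := by
  have hexp : Integrable fun x : Ed d => rexp (-(ε * ‖x‖) - 1) := by
    simp_rw [Real.exp_sub]
    exact (integrable_exp_neg_mul_norm hε).div_const _
  have := integral_sub_integral_exp_le_entropy (hρ.const_mul ε).neg hexp
  simpa only [Pi.neg_apply, integral_neg, integral_const_mul] using this

lemma exists_centered_entropy_add_maxCorr_le [IsProbabilityMeasure ρ] [IsProbabilityMeasure μ]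
    (hρ : FirstMoment ρ) (hμ : FirstMoment μ) (hμc : Centered μ) :
    ∃ ρ' : Measure (Ed d), IsProbabilityMeasure ρ' ∧ FirstMoment ρ' ∧ Centered ρ' ∧
      entropy ρ' + maxCorr ρ' μ ≤ entropy ρ + maxCorr ρ μ := by
  set b : Ed d := -∫ x, x ∂ρ
  have hm : Measurable fun x : Ed d => x + b := measurable_id.add_const b
  have hint : Integrable (fun x => x + b) ρ := hρ.integrable_id.add (integrable_const b)
  refine ⟨ρ.map (· + b), Measure.isProbabilityMeasure_map hm.aemeasurable, ?_, ?_, ?_⟩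
  · exact (integrable_map_measure continuous_norm.aestronglyMeasurable hm.aemeasurable).2 hint.norm
  · rw [Centered, integral_map hm.aemeasurable (f := fun x => x) aestronglyMeasurable_id,
      integral_add hρ.integrable_id (integrable_const b)]
    simp [b]
  · rw [entropy_map_add_right]
    exact add_le_add le_rfl (maxCorr_map_add_le hμ hμc b)

lemma isTightMeasureSet_of_integral_norm_le {S : Set (Measure (Ed d))} {M : ℝ}
    (hS : ∀ ρ ∈ S, FirstMoment ρ ∧ ∫ x, ‖x‖ ∂ρ ≤ M) : IsTightMeasureSet S := by
  refine isTightMeasureSet_of_tendsto_measure_norm_gt ?_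
  have hlim : Tendsto (fun r : ℝ => ENNReal.ofReal (M / r)) atTop (𝓝 0) := by
    simpa using ENNReal.tendsto_ofReal (tendsto_const_nhds.div_atTop tendsto_id)
  refine tendsto_of_tendsto_of_tendsto_of_le_of_le' tendsto_const_nhds hlim
    (Eventually.of_forall fun _ => zero_le) ?_
  filter_upwards [eventually_gt_atTop 0] with r hr
  refine iSup₂_le fun ρ hρ => ?_
  obtain ⟨hρ1, hρM⟩ := hS ρ hρ
  rw [ENNReal.ofReal_div_of_pos hr, ENNReal.le_div_iff_mul_le (by simp [hr]) (by simp), mul_comm]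
  calc ENNReal.ofReal r * ρ {x | r < ‖x‖}
      ≤ ENNReal.ofReal r * ρ {x | ENNReal.ofReal r ≤ ENNReal.ofReal ‖x‖} := by
        gcongr with x
        exact fun hx => ENNReal.ofReal_le_ofReal hx.le
    _ ≤ ∫⁻ x, ENNReal.ofReal ‖x‖ ∂ρ := mul_meas_ge_le_lintegral (by fun_prop) _
    _ = ENNReal.ofReal (∫ x, ‖x‖ ∂ρ) :=
        (ofReal_integral_eq_lintegral_ofReal hρ1 (ae_of_all _ fun _ => norm_nonneg _)).symm
    _ ≤ ENNReal.ofReal M := ENNReal.ofReal_le_ofReal hρM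

lemma firstMoment_of_tendsto {ρs : ℕ → Measure (Ed d)} [IsFiniteMeasure ρ]
    [∀ n, IsFiniteMeasure (ρs n)] (hρs : ∀ n, FirstMoment (ρs n))
    (hlim : ∀ f : BoundedContinuousFunction (Ed d) ℝ,
      Tendsto (fun n => ∫ x, f x ∂(ρs n)) atTop (𝓝 (∫ x, f x ∂ρ)))
    {M : ℝ} (hM : ∀ n, ∫ x, ‖x‖ ∂(ρs n) ≤ M) : FirstMoment ρ := by
  have hcont : ∀ k : ℕ, Continuous fun x : Ed d => min ‖x‖ k := fun k =>
    continuous_norm.min continuous_const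
  have h0 : ∀ (k : ℕ) (x : Ed d), 0 ≤ min ‖x‖ k := fun k x =>
    le_min (norm_nonneg x) k.cast_nonneg
  have hle : ∀ (k : ℕ) (x : Ed d), |min ‖x‖ k| ≤ k := fun k x => by
    rw [abs_of_nonneg (h0 k x)]
    exact min_le_right _ _
  have hbound : ∀ k : ℕ, ∫⁻ x, ENNReal.ofReal (min ‖x‖ k) ∂ρ ≤ ENNReal.ofReal M := by
    intro k
    rw [← ofReal_integral_eq_lintegral_ofReal
      (integrable_of_forall_abs_le (hcont k).measurable (hle k)) (ae_of_all _ (h0 k))]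
    refine ENNReal.ofReal_le_ofReal (le_of_tendsto
      (tendsto_integral_of_abs_le hlim (hcont k) (hle k)) (Eventually.of_forall fun n => ?_))
    exact (integral_mono (integrable_of_forall_abs_le (hcont k).measurable (hle k)) (hρs n)
      fun x => min_le_left _ _).trans (hM n)
  have htend : Tendsto (fun k : ℕ => ∫⁻ x, ENNReal.ofReal (min ‖x‖ k) ∂ρ) atTop
      (𝓝 (∫⁻ x, ENNReal.ofReal ‖x‖ ∂ρ)) := by
    refine lintegral_tendsto_of_tendsto_of_monotone
      (fun k => (hcont k).measurable.ennreal_ofReal.aemeasurable)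
      (ae_of_all _ fun x a b hab => ?_) (ae_of_all _ fun x => ?_)
    · exact ENNReal.ofReal_le_ofReal (min_le_min le_rfl (Nat.cast_le.2 hab))
    · refine tendsto_const_nhds.congr' ?_
      filter_upwards [eventually_ge_atTop ⌈‖x‖⌉₊] with k hk
      rw [min_eq_left ((Nat.le_ceil _).trans (Nat.cast_le.2 hk))]
  refine ⟨continuous_norm.aestronglyMeasurable, ?_⟩
  rw [hasFiniteIntegral_iff_norm]
  simp_rw [norm_norm]
  exact (le_of_tendsto' htend hbound).trans_lt ENNReal.ofReal_lt_top

/-- Measures with uniformly bounded first moments have a weakly convergent subsequence. -/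
lemma exists_subseq_tendsto {ρs : ℕ → Measure (Ed d)} (hp : ∀ n, IsProbabilityMeasure (ρs n))
    (hρs : ∀ n, FirstMoment (ρs n)) {M : ℝ} (hM : ∀ n, ∫ x, ‖x‖ ∂(ρs n) ≤ M) :
    ∃ ρ : Measure (Ed d), IsProbabilityMeasure ρ ∧ FirstMoment ρ ∧ ∃ φ : ℕ → ℕ, StrictMono φ ∧
      ∀ f : BoundedContinuousFunction (Ed d) ℝ,
        Tendsto (fun n => ∫ x, f x ∂(ρs (φ n))) atTop (𝓝 (∫ x, f x ∂ρ)) := by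
  set P : ℕ → ProbabilityMeasure (Ed d) := fun n => ⟨ρs n, hp n⟩
  have htight : IsTightMeasureSet
      {x : Measure (Ed d) | ∃ ν ∈ Set.range P, (ν : Measure (Ed d)) = x} := by
    refine isTightMeasureSet_of_integral_norm_le (M := M) ?_
    rintro _ ⟨_, ⟨n, rfl⟩, rfl⟩
    exact ⟨hρs n, hM n⟩
  obtain ⟨ν, -, φ, hφ, hν⟩ := (isCompact_closure_of_isTightMeasureSet htight).tendsto_subseq
    fun n => subset_closure (Set.mem_range_self n)
  have hlim := ProbabilityMeasure.tendsto_iff_forall_integral_tendsto.1 hν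
  exact ⟨ν, inferInstance,
    firstMoment_of_tendsto (ρs := fun n => ρs (φ n)) (fun n => hρs _) hlim fun n => hM _,
    φ, hφ, hlim⟩

/-- Lower semicontinuity of `E + T` along sequences with bounded first moments. -/
lemma entropy_add_maxCorr_le_of_tendsto {ρs : ℕ → Measure (Ed d)}
    [∀ n, IsProbabilityMeasure (ρs n)] [IsProbabilityMeasure ρ] [IsProbabilityMeasure μ]
    (hρ : FirstMoment ρ) (hρs : ∀ n, FirstMoment (ρs n)) (hμ : FirstMoment μ) (hμc : Centered μ)
    (hlim : ∀ f : BoundedContinuousFunction (Ed d) ℝ,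
      Tendsto (fun n => ∫ x, f x ∂(ρs n)) atTop (𝓝 (∫ x, f x ∂ρ)))
    {M : ℝ} (hM : ∀ n, ∫ x, ‖x‖ ∂(ρs n) ≤ M) {u : ℕ → ℝ} {i : ℝ}
    (hu : Tendsto u atTop (𝓝 i)) (hle : ∀ n, entropy (ρs n) + maxCorr (ρs n) μ ≤ u n) :
    entropy ρ + maxCorr ρ μ ≤ i := by
  refine EReal.add_le_of_forall_lt fun e he t ht => ?_
  induction e with
  | bot => simp
  | top => exact absurd he not_top_lt
  | coe e =>
    induction t with
    | bot => simp
    | top => exact absurd ht not_top_lt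
    | coe t =>
      have hev : ∀ᶠ n in atTop, (e : EReal) < entropy (ρs n) := by
        by_contra hcon
        exact he.not_ge (entropy_le_of_tendsto hρ hρs hlim hM
          ((not_eventually.1 hcon).mono fun n hn => not_lt.1 hn))
      rw [← EReal.coe_add, EReal.coe_le_coe_iff]
      refine le_of_tendsto_of_tendsto tendsto_const_nhds hu ?_
      filter_upwards [hev, eventually_le_maxCorr_of_tendsto hρ hρs hμ hμc hlim ht] with n hn1 hn2
      exact EReal.coe_le_coe_iff.1 ((add_le_add hn1.le hn2).trans (hle n))

lemma exists_pos_forall_le_entropy_add_maxCorr (hd : 1 ≤ d) [IsProbabilityMeasure μ]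
    (hμ : FirstMoment μ) (hμc : Centered μ)
    (hμH : ¬ ∃ e : Ed d, ∃ ℓ : ℝ, ‖e‖ = 1 ∧ μ {y | (⟪y, e⟫ : ℝ) = ℓ} = 1) :
    ∃ ε > 0, ∃ K : ℝ, ∀ ρ : Measure (Ed d), IsProbabilityMeasure ρ → FirstMoment ρ → Centered ρ →
      ((ε * ∫ x, ‖x‖ ∂ρ - K : ℝ) : EReal) ≤ entropy ρ + maxCorr ρ μ := by
  obtain ⟨c, hc, hcT⟩ := exists_pos_forall_mul_integral_norm_le_maxCorr hd hμ hμc hμH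
  refine ⟨c / 2, by positivity, ∫ x : Ed d, rexp (-(c / 2 * ‖x‖) - 1), fun ρ hp hρ hρc => ?_⟩
  refine le_trans (le_of_eq ?_) (add_le_add
    (neg_mul_integral_norm_sub_le_entropy hρ (half_pos hc)) (hcT ρ hp hρ hρc))
  rw [← EReal.coe_add, EReal.coe_eq_coe_iff]
  ring

end Transport

/-- existence of a minimizer of `E(·) + T(·,μ)` over `P_1(ℝ^d)` when `μ` is
centered and not supported on an affine hyperplane. -/
theorem exists_minimizer {d : ℕ} (hd : 1 ≤ d)
    (μ : Measure (Ed d)) [IsProbabilityMeasure μ] (hμ1 : FirstMoment μ) (hμc : Centered μ)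
    (hμH : ¬ ∃ e : Ed d, ∃ ℓ : ℝ, ‖e‖ = 1 ∧ μ {y | (⟪y, e⟫ : ℝ) = ℓ} = 1) :
    ∃ ρ' : Measure (Ed d), IsProbabilityMeasure ρ' ∧ FirstMoment ρ' ∧
      (∃ r : ℝ, entropy ρ' + maxCorr ρ' μ = (r : EReal)) ∧
      ∀ ρ : Measure (Ed d), IsProbabilityMeasure ρ → FirstMoment ρ →
        entropy ρ' + maxCorr ρ' μ ≤ entropy ρ + maxCorr ρ μ := by
  obtain ⟨ε, hε, K, hK⟩ := exists_pos_forall_le_entropy_add_maxCorr hd hμ1 hμc hμH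
  have hbot : ∀ ρ : Measure (Ed d), IsProbabilityMeasure ρ → FirstMoment ρ →
      ((-K : ℝ) : EReal) ≤ entropy ρ + maxCorr ρ μ := by
    intro ρ _ hρ
    obtain ⟨ρ', hp', hρ', hc', hle⟩ := exists_centered_entropy_add_maxCorr_le hρ hμ1 hμc
    refine le_trans ?_ ((hK ρ' hp' hρ' hc').trans hle)
    have : 0 ≤ ε * ∫ x, ‖x‖ ∂ρ' := by positivity
    exact EReal.coe_le_coe_iff.2 (by linarith)
  set I : EReal := ⨅ ρ : {ρ : Measure (Ed d) // IsProbabilityMeasure ρ ∧ FirstMoment ρ},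
    entropy ρ.1 + maxCorr ρ.1 μ
  have hIle : ∀ ρ : Measure (Ed d), IsProbabilityMeasure ρ → FirstMoment ρ →
      I ≤ entropy ρ + maxCorr ρ μ := fun ρ hp hρ => iInf_le _ (⟨ρ, hp, hρ⟩ : {_ρ // _})
  have hItop : I ≠ ⊤ := by
    obtain ⟨ρ, hp, h1, hE⟩ := exists_entropy_ne_top d
    have hρ : FirstMoment ρ := Integrable.of_bound continuous_norm.aestronglyMeasurable 1
      (by simpa using h1)
    refine ((hIle ρ hp hρ).trans_lt (EReal.add_lt_top hE ?_)).ne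
    exact ((maxCorr_le_of_norm_le_one hμ1 h1).trans_lt (EReal.coe_lt_top _)).ne
  have hIbot : I ≠ ⊥ :=
    ((EReal.bot_lt_coe (-K)).trans_le (le_iInf fun ρ => hbot _ ρ.2.1 ρ.2.2)).ne'
  obtain ⟨i, hi⟩ : ∃ i : ℝ, (i : EReal) = I := ⟨I.toReal, EReal.coe_toReal hItop hIbot⟩
  have hseq : ∀ n : ℕ, ∃ ρ : Measure (Ed d), IsProbabilityMeasure ρ ∧ FirstMoment ρ ∧
      Centered ρ ∧ entropy ρ + maxCorr ρ μ ≤ ((i + 1 / ((n : ℝ) + 1) : ℝ) : EReal) := by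
    intro n
    have hlt : I < ((i + 1 / ((n : ℝ) + 1) : ℝ) : EReal) := by
      rw [← hi, EReal.coe_lt_coe_iff]
      linarith [Nat.one_div_pos_of_nat (α := ℝ) (n := n)]
    obtain ⟨⟨ρ, _, hρ⟩, hlt⟩ := iInf_lt_iff.1 hlt
    obtain ⟨ρ', hp', hρ', hc', hle⟩ := exists_centered_entropy_add_maxCorr_le hρ hμ1 hμc
    exact ⟨ρ', hp', hρ', hc', hle.trans hlt.le⟩
  choose ρs hp hρs hc hle using hseq
  have hM : ∀ n, ∫ x, ‖x‖ ∂(ρs n) ≤ (i + 1 + K) / ε := by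
    intro n
    have h1 := EReal.coe_le_coe_iff.1 ((hK _ (hp n) (hρs n) (hc n)).trans (hle n))
    have h2 : 1 / ((n : ℝ) + 1) ≤ 1 := by
      rw [div_le_one (by positivity)]
      linarith [n.cast_nonneg (α := ℝ)]
    rw [le_div_iff₀ hε]
    linarith
  obtain ⟨ρ, hpρ, hρ, φ, hφ, hlim⟩ := exists_subseq_tendsto hp hρs hM
  have hu : Tendsto (fun n : ℕ => i + 1 / ((φ n : ℝ) + 1)) atTop (𝓝 i) := by
    simpa using (tendsto_one_div_add_atTop_nhds_zero_nat.comp hφ.tendsto_atTop).const_add i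
  have hmin : entropy ρ + maxCorr ρ μ ≤ i :=
    entropy_add_maxCorr_le_of_tendsto (ρs := fun n => ρs (φ n)) hρ (fun n => hρs _) hμ1 hμc hlim
      (fun n => hM _) hu fun n => hle _
  refine ⟨ρ, hpρ, hρ, ⟨i, le_antisymm hmin (hi ▸ hIle ρ hpρ hρ)⟩, fun ρ' hp' hρ' => ?_⟩
  exact hmin.trans (hi ▸ hIle ρ' hp' hρ')
end
end
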